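/- arXiv:1408.4744 — 5 statements merged into one kernel-verified Lean document; each statement's English description precedes it below -/
import Mathlib

section
/- Let k be a field, X an integral scheme of finite type over k admitting a locally closed immersion into some projective space ℙⁿ_k (a quasi-projective variety), and G a nonempty set of dominant k-morphisms X → X closed under composition. Then there exist a dense open subscheme X₀ ⊆ X, a countable family (Yᵢ)_{i≥1} of proper closed subsets of X₀ each of which is G-invariant, an integral k-scheme Z of finite type, and a dominant k-morphism φ : X₀ → Z such that: (a) for every g ∈ G, φ ∘ g = φ on the dense open set X₀ ∩ g⁻¹(X₀); and (b) for every field extension K/k and every pair of K-points x, y : Spec K → X that factor through X₀ and whose image points avoid every Yᵢ, one has φ ∘ x = φ ∘ y if and only if the Zariski closures in X_K = X ×_{Spec k} Spec K of the orbit {g ∘ x : g ∈ G} and of the orbit {g ∘ y : g ∈ G} (each orbit viewed as a set of K-points of X_K) coincide. -/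
universe u

open AlgebraicGeometry CategoryTheory CategoryTheory.Limits MvPolynomial

attribute [local instance] MvPolynomial.gradedAlgebra

noncomputable section

/-- Projective `n`-space over the field `k`, as `Proj` of the standard graded polynomial
ring `k[x₀, …, x_{n-1}]`. -/
def ProjectiveSpace (k : Type u) [Field k] (n : ℕ) : Scheme.{u} :=
  Proj (homogeneousSubmodule (Fin n) k)

/-- The structure morphism `ℙⁿ_k ⟶ Spec k`. -/
def projectiveSpaceStruct (k : Type u) [Field k] (n : ℕ) :
    ProjectiveSpace k n ⟶ Spec (CommRingCat.of k) :=
  Proj.toSpecZero _ ≫ Spec.map (CommRingCat.ofHom (algebraMap k _))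

/-- A scheme `X` over `k` (with structure morphism `sX`) is quasi-projective if it admits a
locally closed immersion into some projective space `ℙⁿ_k` over `k`. -/
def IsQuasiProjectiveOver {k : Type u} [Field k] (X : Scheme.{u})
    (sX : X ⟶ Spec (CommRingCat.of k)) : Prop :=
  ∃ (n : ℕ) (ι : X ⟶ ProjectiveSpace k n), IsImmersion ι ∧ ι ≫ projectiveSpaceStruct k n = sX

/-- The structure morphism `Spec K ⟶ Spec k` of a field extension `K/k`. -/
def specOver (k : Type u) [Field k] (K : Type u) [Field K] [Algebra k K] :
    Spec (CommRingCat.of K) ⟶ Spec (CommRingCat.of k) :=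
  Spec.map (CommRingCat.ofHom (algebraMap k K))

/-- The `G`-orbit `{g ∘ x : g ∈ G}` of a `K`-point `x : Spec K ⟶ X`, viewed as a set of
points of the base change `X_K = X ×_{Spec k} Spec K`:  a point `p` of `X_K` belongs to the
orbit iff it is the image of the (unique) `K`-point `w : Spec K ⟶ X_K` whose first projection
is `x ≫ g` and whose second projection is the identity, for some `g ∈ G`. -/
def orbitInBaseChange {k : Type u} [Field k] (X : Scheme.{u})
    (sX : X ⟶ Spec (CommRingCat.of k)) (G : Set (X ⟶ X))
    (K : Type u) [Field K] [Algebra k K] (x : Spec (CommRingCat.of K) ⟶ X) :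
    Set (pullback sX (specOver k K) : Scheme.{u}) :=
  { p | ∃ g ∈ G, ∃ w : Spec (CommRingCat.of K) ⟶ pullback sX (specOver k K),
      w ≫ pullback.fst sX (specOver k K) = x ≫ g ∧
      w ≫ pullback.snd sX (specOver k K) = 𝟙 _ ∧
      p ∈ Set.range w.base }

theorem MvPolynomial.exists_coeffwise {E L σ : Type*} [Field E] [Field L] [Algebra E L]
    (f : L →ₗ[E] E) :
    ∃ Λ : MvPolynomial σ L →+ MvPolynomial σ E,
      (∀ h m, (Λ h).coeff m = f (h.coeff m)) ∧
      ∀ (h : MvPolynomial σ L) (p : MvPolynomial σ E),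
        Λ (h * p.map (algebraMap E L)) = Λ h * p := by
  classical
  have key (h : MvPolynomial σ L) (m) :
      (∑ m ∈ h.support, monomial m (f (h.coeff m))).coeff m = f (h.coeff m) := by
    simp only [coeff_sum, coeff_monomial, Finset.sum_ite_eq', mem_support_iff]
    by_cases hm : h.coeff m = 0 <;> simp [hm]
  refine ⟨AddMonoidHom.mk' (fun h ↦ ∑ m ∈ h.support, monomial m (f (h.coeff m))) fun a b ↦ ?_,
    key, fun h p ↦ ?_⟩
  · ext m
    rw [coeff_add, key, key, key, coeff_add, map_add]
  · ext m
    refine (key _ m).trans ?_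
    rw [coeff_mul, coeff_mul, map_sum]
    refine Finset.sum_congr rfl fun x _ ↦ ?_
    rw [coeff_map, mul_comm, ← Algebra.smul_def, map_smul, smul_eq_mul, mul_comm]
    exact congrArg (· * _) (key h x.1).symm

/-- An intermediate field of a finitely generated extension is finitely generated. -/
theorem IntermediateField.fg_of_essFiniteType {k F : Type*} [Field k] [Field F] [Algebra k F]
    [Algebra.EssFiniteType k F] (L : IntermediateField k F) : L.FG := by
  classical
  obtain ⟨s, hs⟩ := IntermediateField.fg_top (F := k) (E := F)
  let I : Ideal (MvPolynomial s L) := RingHom.ker (aeval (R := L) ((↑) : s → F))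
  obtain ⟨t, ht⟩ : I.FG := IsNoetherian.noetherian I
  let coefs : Set F := ⋃ p ∈ t, (fun c : L ↦ (c : F)) '' (p.coeffs : Set L)
  have hC : coefs.Finite := t.finite_toSet.biUnion fun p _ ↦ p.coeffs.finite_toSet.image _
  let E := IntermediateField.adjoin k coefs
  have hEL : E ≤ L := by
    rw [IntermediateField.adjoin_le_iff]
    intro c hc
    simp only [coefs, Set.mem_iUnion] at hc
    obtain ⟨p, hp, c, hc, rfl⟩ := hc
    exact c.2
  suffices L ≤ E by
    rw [le_antisymm this hEL]
    exact IntermediateField.fg_adjoin_of_finite hC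
  intro c hc
  by_contra hcE
  let _ : Algebra E L := (IntermediateField.inclusion hEL).toRingHom.toAlgebra
  have hmap (e : E) : ((algebraMap E L e : L) : F) = e := rfl
  have hli : LinearIndependent E ![(1 : L), ⟨c, hc⟩] := by
    rw [LinearIndependent.pair_iff]
    intro a b hab
    have hab' : (a : F) + b * c = 0 := by
      have := congrArg (fun x : L ↦ (x : F)) hab
      simpa [Algebra.smul_def, hmap] using this
    by_cases hb : b = 0
    · subst hb
      exact ⟨by simpa using hab', rfl⟩
    · refine absurd ?_ hcE
      have : c = ((-a / b : E) : F) := by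
        have hb' : (b : F) ≠ 0 := by simpa using hb
        push_cast
        field_simp
        linear_combination hab'
      rw [this]
      exact SetLike.coe_mem _
  let B := Module.Basis.extend hli.linearIndepOn_id
  have hmem (i : Fin 2) : ![(1 : L), ⟨c, hc⟩] i ∈ hli.linearIndepOn_id.extend (Set.subset_univ _) :=
    Module.Basis.subset_extend _ (Set.mem_range_self i)
  let f : L →ₗ[E] E := B.coord ⟨_, hmem 1⟩
  have hB (i : Fin 2) : B ⟨_, hmem i⟩ = ![(1 : L), ⟨c, hc⟩] i :=
    Module.Basis.extend_apply_self _ _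
  have hf1 : f 1 = 0 := by
    rw [show (1 : L) = ![(1 : L), ⟨c, hc⟩] 0 from rfl, ← hB 0]
    simp only [f, Module.Basis.coord_apply, Module.Basis.repr_self]
    refine Finsupp.single_eq_of_ne fun h ↦ ?_
    exact absurd (hli.injective (a₁ := 1) (a₂ := 0) (Subtype.ext_iff.1 h)) (by decide)
  have hfc : f ⟨c, hc⟩ = 1 := by
    rw [show (⟨c, hc⟩ : L) = ![(1 : L), ⟨c, hc⟩] 1 from rfl, ← hB 1]
    simp only [f, Module.Basis.coord_apply, Module.Basis.repr_self, Finsupp.single_eq_same]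
  obtain ⟨Λ, hΛ, hΛmul⟩ := MvPolynomial.exists_coeffwise (σ := s) f
  have hlift (p) (hp : p ∈ t) : ∃ q : MvPolynomial s E, q.map (algebraMap E L) = p := by
    refine MvPolynomial.mem_range_map_iff_coeffs_subset.2 fun d hd ↦ ?_
    exact ⟨⟨d, IntermediateField.subset_adjoin _ _ (Set.mem_biUnion hp ⟨d, hd, rfl⟩)⟩, rfl⟩
  have haev (q : MvPolynomial s E) : aeval ((↑) : s → F) (q.map (algebraMap E L)) =
      aeval ((↑) : s → F) q := by
    simp only [aeval_def, eval₂_map]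
    rfl
  have hΛI (h) (hh : h ∈ I) : aeval ((↑) : s → F) (Λ h) = 0 := by
    rw [← ht] at hh
    suffices ∀ a, aeval ((↑) : s → F) (Λ (a * h)) = 0 by simpa using this 1
    refine Submodule.span_induction (p := fun h _ ↦ ∀ a, aeval ((↑) : s → F) (Λ (a * h)) = 0)
      ?_ (by simp) (fun x y _ _ hx hy a ↦ by rw [mul_add, map_add, map_add, hx, hy, add_zero])
      (fun b x _ hx a ↦ by rw [smul_eq_mul, ← mul_assoc, hx]) hh
    intro p hp a
    obtain ⟨q, rfl⟩ := hlift p hp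
    rw [hΛmul, map_mul, ← haev q, show aeval ((↑) : s → F) (q.map (algebraMap E L)) = 0 from
      (ht ▸ Ideal.subset_span hp : q.map (algebraMap E L) ∈ I), mul_zero]
  have hcF : c ∈ IntermediateField.adjoin k (s : Set F) := hs ▸ trivial
  obtain ⟨r, hr, d, hd, hrd⟩ := IntermediateField.mem_adjoin_iff_div.1 hcF
  have hrange (x : F) (hx : x ∈ Algebra.adjoin k (s : Set F)) :
      ∃ q : MvPolynomial s E, aeval ((↑) : s → F) q = x := by
    obtain ⟨q, rfl⟩ : ∃ q : MvPolynomial s k, aeval ((↑) : s → F) q = x := by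
      rw [← Subtype.range_coe (s := (s : Set F)), Algebra.adjoin_range_eq_range_aeval] at hx
      exact hx
    exact ⟨q.map (algebraMap k E), by simp [aeval_map_algebraMap]⟩
  obtain ⟨p, rfl⟩ := hrange r hr
  obtain ⟨q, rfl⟩ := hrange d hd
  have hΛC (x : L) : Λ (C x) = C (f x) := by
    ext m
    rw [hΛ, coeff_C, coeff_C]
    split_ifs <;> simp
  have hq0 : aeval ((↑) : s → F) q ≠ 0 := by
    intro h0
    rw [h0, div_zero] at hrd
    exact hcE (hrd ▸ zero_mem E)
  refine hq0 (neg_eq_zero.1 ?_)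
  have := hΛI (C 1 * p.map (algebraMap E L) - C ⟨c, hc⟩ * q.map (algebraMap E L)) (by
    have hcL : algebraMap L F ⟨c, hc⟩ = c := rfl
    change aeval _ _ = 0
    rw [map_sub, map_mul, map_mul, haev, haev, aeval_C, aeval_C, hcL, hrd, map_one, one_mul,
      div_mul_cancel₀ _ hq0, sub_self])
  rw [map_sub, hΛmul, hΛmul, hΛC, hΛC, hf1, hfc] at this
  simpa using this

theorem exists_finset_subset_adjoin (k : Type*) {F : Type*} [Field k] [Field F] [Algebra k F]
    [Algebra.EssFiniteType k F] (T : Set F) :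
    ∃ S : Finset F, (S : Set F) ⊆ T ∧ T ⊆ IntermediateField.adjoin k (S : Set F) := by
  classical
  obtain ⟨s, hs⟩ := (IntermediateField.adjoin k T).fg_of_essFiniteType
  have (x : s) : ∃ U : Finset F, (U : Set F) ⊆ T ∧
      (x : F) ∈ IntermediateField.adjoin k (U : Set F) :=
    IntermediateField.exists_finset_of_mem_adjoin (hs ▸ IntermediateField.subset_adjoin _ _ x.2)
  choose U hUT hU using this
  refine ⟨Finset.univ.biUnion U, by simpa using hUT, ?_⟩
  have : IntermediateField.adjoin k T ≤
      IntermediateField.adjoin k (Finset.univ.biUnion U : Finset F) := by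
    rw [← hs, IntermediateField.adjoin_le_iff]
    intro x hx
    exact IntermediateField.adjoin.mono _ _ _
      (by exact_mod_cast Finset.subset_biUnion_of_mem U (Finset.mem_univ ⟨x, hx⟩)) (hU ⟨x, hx⟩)
  exact (IntermediateField.subset_adjoin k T).trans this

/-- Finitely many functions are linearly independent as soon as they have a nonzero minor. -/
theorem exists_det_ne_zero_of_linearIndependent {K Γ S : Type*} [Field K] [Fintype S]
    [DecidableEq S] {C : S → Γ → K} (hC : LinearIndependent K C) :
    ∃ γ : S → Γ, (Matrix.of fun s t ↦ C t (γ s)).det ≠ 0 := by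
  classical
  let w : Γ → S → K := fun g s ↦ C s g
  have hw : Submodule.span K (Set.range w) = ⊤ := by
    by_contra hne
    obtain ⟨φ, hφ, hle⟩ := Submodule.exists_le_ker_of_lt_top _ (lt_top_iff_ne_top.2 hne)
    refine hφ (LinearMap.pi_ext' fun s ↦ LinearMap.ext_ring ?_)
    refine Fintype.linearIndependent_iff.1 hC (fun s ↦ φ (Pi.single s 1)) ?_ s
    ext g
    have : φ (w g) = 0 := hle (Submodule.subset_span ⟨g, rfl⟩)
    rw [LinearMap.pi_apply_eq_sum_univ] at this
    simpa [mul_comm, w, ← Pi.single_apply, Pi.single_comm] using this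
  obtain ⟨b, hb, hspan, hli⟩ := exists_linearIndependent K (Set.range w)
  let B : Module.Basis b K (S → K) := Module.Basis.mk hli (by simp [hspan, hw])
  let e : S ≃ b := (Pi.basisFun K S).indexEquiv B
  choose γ hγ using fun s ↦ hb (e s).2
  refine ⟨γ, ?_⟩
  have : LinearIndependent K (Matrix.of fun s t ↦ C t (γ s)).row := by
    have := hli.comp e e.injective
    have hrow : (Matrix.of fun s t ↦ C t (γ s)).row = Subtype.val ∘ e := funext hγ
    rw [hrow]
    exact this
  exact ((Matrix.isUnit_iff_isUnit_det _).1
    (Matrix.linearIndependent_rows_iff_isUnit.1 this)).ne_zero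

theorem linearIndependent_of_det_ne_zero {K Γ S : Type*} [Field K] [Fintype S]
    [DecidableEq S] {C : S → Γ → K} (γ : S → Γ)
    (h : (Matrix.of fun s t ↦ C t (γ s)).det ≠ 0) : LinearIndependent K C := by
  have := Matrix.linearIndependent_cols_of_det_ne_zero h
  refine LinearIndependent.of_comp (LinearMap.funLeft K K γ) ?_
  exact this

/-- Entrywise application of a field homomorphism preserves linear independence. -/
theorem LinearIndependent.map_entries {K L Γ J : Type*} [Field K] [Field L] {C : J → Γ → K}
    (hC : LinearIndependent K C) (σ : K →+* L) :
    LinearIndependent L fun j g ↦ σ (C j g) := by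
  classical
  rw [linearIndependent_iff_finset_linearIndependent] at hC ⊢
  intro s
  obtain ⟨γ, hγ⟩ := exists_det_ne_zero_of_linearIndependent (hC s)
  refine linearIndependent_of_det_ne_zero γ ?_
  have := (map_ne_zero σ).2 hγ
  rwa [RingHom.map_det] at this

theorem linearCombination_eq_zero_iff_of_coords {K V ι : Type*} [Field K] [AddCommGroup V]
    [Module K V] {v : ι → V} {J : Set ι} (hv : LinearIndependent K fun j : J ↦ v j)
    (s : ι → Finset J) (a : ι → J → K) (ha : ∀ i, v i = ∑ j ∈ s i, a i j • v j) (c : ι →₀ K) :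
    Finsupp.linearCombination K v c = 0 ↔
      c.sum (fun i x ↦ x • ∑ j ∈ s i, Finsupp.single j (a i j)) = 0 := by
  have : Finsupp.linearCombination K v c = Finsupp.linearCombination K (fun j : J ↦ v j)
      (c.sum (fun i x ↦ x • ∑ j ∈ s i, Finsupp.single j (a i j))) := by
    rw [Finsupp.linearCombination_apply, Finsupp.sum, Finsupp.sum, map_sum]
    refine Finset.sum_congr rfl fun i _ ↦ ?_
    rw [map_smul, map_sum]
    simp only [Finsupp.linearCombination_single]
    rw [← ha]
  rw [this]
  exact ⟨fun h ↦ linearIndependent_iff.1 hv _ h, fun h ↦ by rw [h, map_zero]⟩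

/-- The relations between two families of vectors with bases indexed by the same set agree exactly when
the coordinates with respect to these bases do. -/
theorem relations_eq_iff_coords_eq {K V W ι : Type*} [Field K] [AddCommGroup V] [Module K V]
    [AddCommGroup W] [Module K W] {v : ι → V} {w : ι → W} {J : Set ι}
    (hv : LinearIndependent K fun j : J ↦ v j) (hw : LinearIndependent K fun j : J ↦ w j)
    (s : ι → Finset J) (a b : ι → J → K) (ha : ∀ i, v i = ∑ j ∈ s i, a i j • v j)
    (hb : ∀ i, w i = ∑ j ∈ s i, b i j • w j) :
    (∀ c : ι →₀ K, Finsupp.linearCombination K v c = 0 ↔ Finsupp.linearCombination K w c = 0) ↔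
      ∀ i, ∀ j ∈ s i, a i j = b i j := by
  classical
  constructor
  · intro h i
    let c : ι →₀ K := Finsupp.single i 1 - ∑ j ∈ s i, Finsupp.single (j : ι) (a i j)
    have hc : Finsupp.linearCombination K v c = 0 := by
      simp [c, ← ha i]
    have hc' := (h c).1 hc
    simp only [c, map_sub, map_sum, Finsupp.linearCombination_single, one_smul] at hc'
    rw [hb i, ← Finset.sum_sub_distrib] at hc'
    simp only [← sub_smul] at hc'
    intro j hj
    exact (sub_eq_zero.1 (linearIndependent_iff'.1 hw (s i) _ hc' j hj)).symm
  · intro h c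
    rw [linearCombination_eq_zero_iff_of_coords hv s a ha,
      linearCombination_eq_zero_iff_of_coords hw s a
        fun i ↦ (hb i).trans (Finset.sum_congr rfl fun j hj ↦ by rw [h i j hj])]

/-- A linear relation with coefficients that are fractions over a domain `R` specializes along
any homomorphism `θ : R → K` which does not kill the denominators. -/
theorem specialize_relation {R F K J : Type*} [CommRing R] [Field F] [Field K] (i : R →+* F)
    (hi : Function.Injective i) (θ : R →+* K) (s : Finset J) (l : J → F) (p q u : J → R) (v : R)
    (hl : ∀ j ∈ s, i (q j) * l j = i (p j)) (hq : ∀ j ∈ s, θ (q j) ≠ 0)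
    (h : i v = ∑ j ∈ s, l j * i (u j)) :
    θ v = ∑ j ∈ s, θ (p j) / θ (q j) * θ (u j) := by
  classical
  have h1 : (∏ j ∈ s, q j) * v = ∑ j ∈ s, (∏ j' ∈ s.erase j, q j') * p j * u j := by
    apply hi
    rw [map_mul, h, Finset.mul_sum, map_sum]
    refine Finset.sum_congr rfl fun j hj ↦ ?_
    rw [← Finset.mul_prod_erase s q hj, map_mul, map_mul, map_mul, ← hl j hj]
    ring
  have h2 : (∏ j ∈ s, θ (q j)) ≠ 0 := Finset.prod_ne_zero_iff.2 hq
  refine mul_left_cancel₀ h2 ?_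
  have := congrArg θ h1
  rw [map_mul, map_prod, map_sum] at this
  rw [this, Finset.mul_sum]
  refine Finset.sum_congr rfl fun j hj ↦ ?_
  rw [← Finset.mul_prod_erase s _ hj, map_mul, map_mul, map_prod]
  field_simp [hq j hj]

namespace AlgebraicGeometry

/-- The closed point of the spectrum of a field. -/
abbrev specPt (K : Type u) [Field K] : Spec (.of K) := IsLocalRing.closedPoint K

theorem eq_specPt {K : Type u} [Field K] (p : Spec (.of K)) : p = specPt K :=
  Subsingleton.elim (α := PrimeSpectrum K) _ _

theorem top_le_preimage_iff {X : Scheme.{u}} {K : Type u} [Field K] (z : Spec (.of K) ⟶ X)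
    (U : X.Opens) : ⊤ ≤ z ⁻¹ᵁ U ↔ z (specPt K) ∈ U :=
  ⟨fun h ↦ h trivial, fun h p _ ↦ by rw [eq_specPt p]; exact h⟩

/-- Evaluation of sections at a field-valued point. -/
def pointEval {X : Scheme.{u}} {K : Type u} [Field K] (z : Spec (.of K) ⟶ X) (U : X.Opens)
    (h : z (specPt K) ∈ U) : Γ(X, U) →+* K :=
  (z.appLE U ⊤ ((top_le_preimage_iff z U).2 h) ≫ (Scheme.ΓSpecIso (.of K)).hom).hom

theorem pointEval_comp {X Y : Scheme.{u}} {K : Type u} [Field K] (z : Spec (.of K) ⟶ X)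
    (g : X ⟶ Y) (U : Y.Opens) (W : X.Opens) (e : W ≤ g ⁻¹ᵁ U) (h : (z ≫ g) (specPt K) ∈ U)
    (h' : z (specPt K) ∈ W) (a : Γ(Y, U)) :
    pointEval (z ≫ g) U h a = pointEval z W h' (g.appLE U W e a) := by
  have := Scheme.Hom.appLE_comp_appLE z g U W ⊤ e ((top_le_preimage_iff z W).2 h')
  exact congr((Scheme.ΓSpecIso (.of K)).hom ($this.symm a))

theorem pointEval_map {X : Scheme.{u}} {K : Type u} [Field K] (z : Spec (.of K) ⟶ X)
    (U W : X.Opens) (e : W ≤ U) (h : z (specPt K) ∈ U)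
    (h' : z (specPt K) ∈ W) (a : Γ(X, U)) :
    pointEval z W h' (X.presheaf.map (homOfLE e).op a) = pointEval z U h a := by
  have := Scheme.Hom.map_appLE z ((top_le_preimage_iff z W).2 h') (homOfLE e).op
  exact congr((Scheme.ΓSpecIso (.of K)).hom ($this a))

theorem pointEval_specMap {X : Scheme.{u}} {K L : Type u} [Field K] [Field L]
    (z : Spec (.of K) ⟶ X) (σ : K →+* L) (U : X.Opens) (h : z (specPt K) ∈ U)
    (h' : (Spec.map (CommRingCat.ofHom σ) ≫ z) (specPt L) ∈ U) (a : Γ(X, U)) :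
    pointEval (Spec.map (CommRingCat.ofHom σ) ≫ z) U h' a = σ (pointEval z U h a) := by
  have := pointEval_comp (Spec.map (CommRingCat.ofHom σ)) z U ⊤ ((top_le_preimage_iff z U).2 h) h'
    trivial a
  rw [this]
  have h2 := Scheme.ΓSpecIso_naturality (CommRingCat.ofHom σ)
  refine Eq.trans ?_ congr($h2 ((z.appLE U ⊤ ((top_le_preimage_iff z U).2 h)) a))
  exact congr((Scheme.ΓSpecIso (.of L)).hom ($(Scheme.Hom.appLE_eq_app
    (Spec.map (CommRingCat.ofHom σ)) (U := ⊤)) _))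

theorem specMap_apply_specPt {X : Scheme.{u}} {K L : Type u} [Field K] [Field L]
    (z : Spec (.of K) ⟶ X) (σ : K →+* L) :
    (Spec.map (CommRingCat.ofHom σ) ≫ z) (specPt L) = z (specPt K) := by
  rw [Scheme.Hom.comp_apply]
  congr 1
  exact eq_specPt _

theorem mem_basicOpen_iff_pointEval {X : Scheme.{u}} {K : Type u} [Field K]
    (z : Spec (.of K) ⟶ X) (U : X.Opens) (h : z (specPt K) ∈ U) (f : Γ(X, U)) :
    z (specPt K) ∈ X.basicOpen f ↔ pointEval z U h f ≠ 0 := by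
  have e := (top_le_preimage_iff z U).2 h
  have : z (specPt K) ∈ X.basicOpen f ↔ specPt K ∈ (Spec (.of K)).basicOpen (z.appLE U ⊤ e f) := by
    have := Scheme.Hom.preimage_basicOpen z f
    change specPt K ∈ z ⁻¹ᵁ X.basicOpen f ↔ _
    rw [this, Scheme.Hom.appLE]
    simp
  rw [this, basicOpen_eq_of_affine']
  simp only [pointEval]
  change _ ∉ _ ↔ _
  simp [IsLocalRing.closedPoint]


/-- The generic point of an integral scheme, as a point valued in the function field. -/
def genPt (X : Scheme.{u}) [IsIntegral X] : Spec (.of X.functionField) ⟶ X :=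
  X.fromSpecStalk (genericPoint X)

theorem genPt_specPt (X : Scheme.{u}) [IsIntegral X] :
    genPt X (specPt X.functionField) = genericPoint X :=
  Scheme.fromSpecStalk_closedPoint

theorem genericPoint_mem {X : Scheme.{u}} [IsIntegral X] (U : X.Opens) [hU : Nonempty U] :
    genericPoint X ∈ U :=
  ((genericPoint_spec X).mem_open_set_iff U.2).2 (by simpa using hU)

theorem genPt_mem {X : Scheme.{u}} [IsIntegral X] (U : X.Opens) [hU : Nonempty U] :
    genPt X (specPt X.functionField) ∈ U := by
  rw [genPt_specPt]
  exact genericPoint_mem U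

theorem fromSpecStalk_appLE_comp_ΓSpecIso_hom {X : Scheme.{u}} {p : X} {U : X.Opens} (hp : p ∈ U)
    (h : ⊤ ≤ X.fromSpecStalk p ⁻¹ᵁ U) :
    (X.fromSpecStalk p).appLE U ⊤ h ≫ (Scheme.ΓSpecIso _).hom = X.presheaf.germ U p hp := by
  rw [Scheme.Hom.appLE, Scheme.fromSpecStalk_app hp, Category.assoc, Category.assoc, Category.assoc,
    ← Functor.map_comp_assoc]
  have : (Spec (X.presheaf.stalk p)).presheaf.map
      ((homOfLE (le_top : X.fromSpecStalk p ⁻¹ᵁ U ≤ ⊤)).op ≫ (homOfLE h).op) = 𝟙 _ :=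
    (Spec (X.presheaf.stalk p)).presheaf.map_id _
  rw [this, Category.id_comp, Iso.inv_hom_id, Category.comp_id]

theorem pointEval_genPt {X : Scheme.{u}} [IsIntegral X] (U : X.Opens) [hU : Nonempty U]
    (h : genPt X (specPt X.functionField) ∈ U) (a : Γ(X, U)) :
    pointEval (genPt X) U h a = algebraMap Γ(X, U) X.functionField a :=
  congr($(fromSpecStalk_appLE_comp_ΓSpecIso_hom (genericPoint_mem U)
    ((top_le_preimage_iff (genPt X) U).2 h)) a)

theorem pointEval_genPt_injective {X : Scheme.{u}} [IsIntegral X] (U : X.Opens)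
    (h : genPt X (specPt X.functionField) ∈ U) : Function.Injective (pointEval (genPt X) U h) := by
  have : Nonempty U := ⟨_, h⟩
  intro a b hab
  rw [pointEval_genPt, pointEval_genPt] at hab
  exact germ_injective_of_isIntegral X _ (genericPoint_mem U) hab

theorem exists_specMap_comp_genPt {X : Scheme.{u}} [IsIntegral X] {K : Type u} [Field K]
    (z : Spec (.of K) ⟶ X) (hz : z (specPt K) = genericPoint X) :
    ∃ σ : X.functionField →+* K, z = Spec.map (CommRingCat.ofHom σ) ≫ genPt X := by
  suffices ∀ (p : X) (s : X.presheaf.stalk p ⟶ .of K), p = genericPoint X →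
      Spec.map s ≫ X.fromSpecStalk p = z →
      ∃ σ : X.functionField →+* K, z = Spec.map (CommRingCat.ofHom σ) ≫ genPt X from
    this _ _ hz (Scheme.Spec_stalkClosedPointTo_fromSpecStalk z)
  rintro p s rfl rfl
  exact ⟨s.hom, rfl⟩

theorem map_genericPoint {X Y : Scheme.{u}} [IsIntegral X] [IsIntegral Y] (g : X ⟶ Y)
    [IsDominant g] : g (genericPoint X) = genericPoint Y := by
  apply ((genericPoint_spec Y).eq _).symm
  simpa [g.denseRange.closure_range] using (genericPoint_spec X).image g.continuous

theorem exists_specMap_eq_genPt_comp {X : Scheme.{u}} [IsIntegral X] (g : X ⟶ X) [IsDominant g] :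
    ∃ σ : X.functionField →+* X.functionField,
      genPt X ≫ g = Spec.map (CommRingCat.ofHom σ) ≫ genPt X := by
  refine exists_specMap_comp_genPt _ ?_
  rw [Scheme.Hom.comp_apply, genPt_specPt, map_genericPoint]

section OverField

variable {k : Type u} [Field k] {X : Scheme.{u}} (sX : X ⟶ Spec (.of k))

/-- The map from the base field to the sections over an open subset. -/
def baseToSections (U : X.Opens) : k →+* Γ(X, U) :=
  ((Scheme.ΓSpecIso (.of k)).inv ≫ sX.appLE ⊤ U le_top).hom

theorem appLE_baseToSections (g : X ⟶ X) (hg : g ≫ sX = sX) (U W : X.Opens) (e : W ≤ g ⁻¹ᵁ U)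
    (c : k) : g.appLE U W e (baseToSections sX U c) = baseToSections sX W c := by
  have := Scheme.Hom.appLE_comp_appLE g sX ⊤ U W le_top e
  simp only [hg] at this
  exact congr($this ((Scheme.ΓSpecIso (.of k)).inv c))

theorem map_baseToSections (U W : X.Opens) (e : W ≤ U) (c : k) :
    X.presheaf.map (homOfLE e).op (baseToSections sX U c) = baseToSections sX W c :=
  congr($(Scheme.Hom.appLE_map sX le_top (homOfLE e).op) ((Scheme.ΓSpecIso (.of k)).inv c))

theorem pointEval_specMap_top {K : Type u} [Field K] (σ : k →+* K)
    (h : Spec.map (CommRingCat.ofHom σ) (specPt K) ∈ (⊤ : (Spec (.of k)).Opens)) (c : k) :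
    pointEval (Spec.map (CommRingCat.ofHom σ)) ⊤ h ((Scheme.ΓSpecIso (.of k)).inv c) = σ c := by
  have h1 := Scheme.Hom.appLE_eq_app (Spec.map (CommRingCat.ofHom σ)) (U := ⊤)
  have h2 := Scheme.ΓSpecIso_naturality (CommRingCat.ofHom σ)
  have h3 : (Scheme.ΓSpecIso (.of k)).inv ≫ (Spec.map (CommRingCat.ofHom σ)).appTop ≫
    (Scheme.ΓSpecIso (.of K)).hom = CommRingCat.ofHom σ := by rw [h2, Iso.inv_hom_id_assoc]
  refine Eq.trans ?_ congr($h3 c)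
  exact congr((Scheme.ΓSpecIso (.of K)).hom ($h1 _))

theorem pointEval_baseToSections {K : Type u} [Field K] (σ : k →+* K)
    (z : Spec (.of K) ⟶ X) (hz : z ≫ sX = Spec.map (CommRingCat.ofHom σ)) (U : X.Opens)
    (h : z (specPt K) ∈ U) (c : k) : pointEval z U h (baseToSections sX U c) = σ c := by
  rw [← pointEval_specMap_top σ trivial]
  simp only [← hz]
  exact (pointEval_comp z sX ⊤ U le_top trivial h _).symm

theorem baseToSections_finiteType [LocallyOfFiniteType sX] {U : X.Opens} (hU : IsAffineOpen U) :
    (baseToSections sX U).FiniteType := by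
  have h1 := Scheme.Hom.finiteType_appLE sX (isAffineOpen_top _) hU le_top
  exact h1.comp (RingHom.FiniteType.of_surjective _
    (ConcreteCategory.bijective_of_isIso (Scheme.ΓSpecIso (.of k)).inv).2)

/-- Sections over an affine open subset of a scheme of finite type over a field are spanned by
countably many sections. -/
theorem exists_nat_spanning [LocallyOfFiniteType sX] {U : X.Opens} (hU : IsAffineOpen U) :
    ∃ a : ℕ → Γ(X, U), ∀ f : Γ(X, U), ∃ c : ℕ →₀ k,
      f = c.sum fun i r ↦ baseToSections sX U r * a i := by
  let _ : Algebra k Γ(X, U) := (baseToSections sX U).toAlgebra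
  have hft : Algebra.FiniteType k Γ(X, U) := baseToSections_finiteType sX hU
  obtain ⟨n, F, hF⟩ := Algebra.FiniteType.iff_quotient_mvPolynomial''.1 hft
  obtain ⟨e, he⟩ := exists_surjective_nat (Fin n →₀ ℕ)
  obtain ⟨e', he'⟩ := he.hasRightInverse
  refine ⟨fun i ↦ F (monomial (e i) 1), fun f ↦ ?_⟩
  obtain ⟨p, rfl⟩ := hF f
  refine ⟨∑ m ∈ p.support, Finsupp.single (e' m) (p.coeff m), ?_⟩
  rw [← Finsupp.sum_finsetSum_index (by simp) (by simp [add_mul])]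
  conv_lhs => rw [p.as_sum, map_sum]
  refine Finset.sum_congr rfl fun m _ ↦ ?_
  have : monomial m (coeff m p) = coeff m p • monomial m (1 : k) := by simp [smul_monomial]
  rw [this, map_smul, Algebra.smul_def, Finsupp.sum_single_index (by simp)]
  simp only [he' m]
  rfl

theorem exists_nat_affine_cover [IsIntegral X] [QuasiCompact sX] :
    ∃ U : ℕ → X.Opens, (∀ i, IsAffineOpen (U i)) ∧ (∀ i, Nonempty (U i)) ∧ ∀ x, ∃ i, x ∈ U i := by
  have : CompactSpace X := QuasiCompact.compactSpace_of_compactSpace sX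
  obtain ⟨s, hs, e⟩ := isCompact_iff_finite_and_eq_biUnion_affineOpens.1
    (show IsCompact ((⊤ : X.Opens) : Set X) from isCompact_univ)
  let t : Set X.Opens := {V | Nonempty V ∧ ∃ W ∈ s, (W : X.Opens) = V}
  have ht : t.Countable :=
    ((hs.image (Subtype.val : X.affineOpens → X.Opens)).subset fun V hV ↦ hV.2).countable
  have hcov (x : X) : ∃ V ∈ t, x ∈ V := by
    have hx : x ∈ (⊤ : X.Opens) := trivial
    rw [e] at hx
    simp only [TopologicalSpace.Opens.mem_iSup] at hx
    obtain ⟨W, hW, hx⟩ := hx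
    exact ⟨W, ⟨⟨x, hx⟩, W, hW, rfl⟩, hx⟩
  obtain ⟨V, hV, -⟩ := hcov (genericPoint X)
  obtain ⟨U, hUt⟩ := ht.exists_eq_range ⟨V, hV⟩
  have hU (i) : U i ∈ t := hUt ▸ Set.mem_range_self i
  refine ⟨U, fun i ↦ ?_, fun i ↦ (hU i).1, fun x ↦ ?_⟩
  · obtain ⟨W, -, hW⟩ := (hU i).2
    exact hW ▸ W.2
  · obtain ⟨V, hV, hx⟩ := hcov x
    obtain ⟨i, rfl⟩ := hUt ▸ hV
    exact ⟨i, hx⟩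

/-- The function field is essentially of finite type over the base field. -/
theorem essFiniteType_functionField [IsIntegral X] [LocallyOfFiniteType sX] {U : X.Opens}
    (hU : IsAffineOpen U) [Nonempty U] :
    @Algebra.EssFiniteType k X.functionField _ _
      ((algebraMap Γ(X, U) X.functionField).comp (baseToSections sX U)).toAlgebra := by
  let _ : Algebra k Γ(X, U) := (baseToSections sX U).toAlgebra
  have hft : Algebra.FiniteType k Γ(X, U) := baseToSections_finiteType sX hU
  let _ : Algebra k X.functionField :=
    ((algebraMap Γ(X, U) X.functionField).comp (baseToSections sX U)).toAlgebra
  have : IsScalarTower k Γ(X, U) X.functionField := .of_algebraMap_eq' rfl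
  have := functionField_isFractionRing_of_isAffineOpen X U hU
  have := Algebra.EssFiniteType.of_isLocalization X.functionField (nonZeroDivisors Γ(X, U))
  exact .comp k Γ(X, U) X.functionField

end OverField

/-- Finitely many rational functions are regular on a common nonempty affine open subset. -/
theorem exists_affine_forall_regular {X : Scheme.{u}} [IsIntegral X] (S : Finset X.functionField) :
    ∃ (W : X.Opens) (_ : IsAffineOpen W) (h : genPt X (specPt X.functionField) ∈ W),
      ∀ s ∈ S, ∃ c : Γ(X, W), pointEval (genPt X) W h c = s := by
  choose V hV c hc using fun s : S ↦ X.presheaf.exists_germ_eq (x := genericPoint X) s.1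
  obtain ⟨W, ⟨W, hW, rfl⟩, hx, hWV⟩ := X.isBasis_affineOpens.exists_subset_of_mem_open
    (show genericPoint X ∈ (⋂ s, (V s : Set X)) from Set.mem_iInter.2 hV)
    (isOpen_iInter_of_finite fun s ↦ (V s).2)
  have hWV' (s) : W ≤ V s := fun x hx ↦ Set.mem_iInter.1 (hWV hx) s
  have hgen := (genPt_specPt X).symm ▸ hx
  refine ⟨W, hW, hgen, fun s hs ↦
    ⟨X.presheaf.map (homOfLE (hWV' ⟨s, hs⟩)).op (c ⟨s, hs⟩), ?_⟩⟩
  have : Nonempty (V ⟨s, hs⟩) := ⟨_, hV _⟩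
  rw [pointEval_map (genPt X) _ W (hWV' ⟨s, hs⟩) (genPt_mem _), pointEval_genPt]
  exact hc ⟨s, hs⟩

theorem comp_opensToSpecΓ {X : Scheme.{u}} {K : Type u} [Field K] (W : X.Opens)
    (z : Spec (.of K) ⟶ W) (h : (z ≫ W.ι) (specPt K) ∈ W) :
    z ≫ W.toSpecΓ = Spec.map (CommRingCat.ofHom (pointEval (z ≫ W.ι) W h)) := by
  let f := z ≫ W.ι
  have e : ⊤ ≤ f ⁻¹ᵁ W := (top_le_preimage_iff f W).2 h
  have h1 := Scheme.Opens.toSpecΓ_SpecMap_appLE f W ⊤ e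
  have h2 : f.resLE W ⊤ e = Scheme.Opens.ι ⊤ ≫ z := by
    rw [← cancel_mono W.ι, Scheme.Hom.resLE_comp_ι, Category.assoc]
  have : IsIso (Scheme.Opens.ι (⊤ : (Spec (.of K)).Opens)) :=
    inferInstanceAs (IsIso (Scheme.topIso _).hom)
  rw [h2, Scheme.Opens.toSpecΓ_top, Category.assoc, Category.assoc, cancel_epi] at h1
  rw [← h1, ← SpecMap_ΓSpecIso_hom, ← Spec.map_comp]
  rfl

end AlgebraicGeometry

theorem CommRingCat.exists_sum_of_isPushout {R A B D : CommRingCat.{u}} {f : R ⟶ A} {g : R ⟶ B}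
    {inl : A ⟶ D} {inr : B ⟶ D} (h : IsPushout f g inl inr) {ι : Type*} (a : ι → A)
    (ha : ∀ x : A, ∃ c : ι →₀ R, x = c.sum fun i r ↦ f r * a i) (d : D) :
    ∃ c : ι →₀ B, d = c.sum fun i r ↦ inr r * inl (a i) := by
  classical
  let _ : Algebra R A := f.hom.toAlgebra
  let _ : Algebra R B := g.hom.toAlgebra
  have h' := CommRingCat.isPushout_tensorProduct R A B
  let e := h'.isoIsPushout _ _ h
  have hl (x : A) : e.hom (x ⊗ₜ[R] (1 : B)) = inl x :=
    congr($(h'.inl_isoIsPushout_hom _ _ h) x)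
  have hr (x : B) : e.hom ((1 : A) ⊗ₜ[R] x) = inr x :=
    congr($(h'.inr_isoIsPushout_hom _ _ h) x)
  have hfg (r : R) : inl (f r) = inr (g r) := congr($h.w r)
  obtain ⟨t, rfl⟩ := (ConcreteCategory.bijective_of_isIso e.hom).2 d
  change TensorProduct R A B at t
  induction t using TensorProduct.induction_on with
  | zero => exact ⟨0, by simp⟩
  | add x y hx hy =>
    obtain ⟨c, hc⟩ := hx
    obtain ⟨c', hc'⟩ := hy
    refine ⟨c + c', ?_⟩
    rw [Finsupp.sum_add_index' (by simp) (by simp [add_mul]), ← hc, ← hc']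
    exact map_add _ _ _
  | tmul x y =>
    obtain ⟨c, hc⟩ := ha x
    refine ⟨c.mapRange (fun r ↦ g r * y) (by simp), ?_⟩
    have : x ⊗ₜ[R] y = (x ⊗ₜ[R] (1 : B)) * ((1 : A) ⊗ₜ[R] y) := by simp
    rw [this]
    refine (map_mul e.hom.hom _ _).trans ?_
    refine congr($(hl x) * $(hr y)).trans ?_
    rw [Finsupp.sum_mapRange_index (by simp), hc, Finsupp.sum, map_sum, Finset.sum_mul]
    refine Finset.sum_congr rfl fun i _ ↦ ?_
    simp only [map_mul, hfg]
    ring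

namespace AlgebraicGeometry

section BaseChange

variable {k : Type u} [Field k] {X : Scheme.{u}} (sX : X ⟶ Spec (.of k))
  (K : Type u) [Field K] [Algebra k K]

/-- The section of the base change `X_K` defined by a `K`-linear combination of sections. -/
def baseChangeSection (U : X.Opens) (a : ℕ → Γ(X, U)) (c : ℕ →₀ K) :
    Γ(pullback sX (specOver k K), pullback.fst sX (specOver k K) ⁻¹ᵁ U) :=
  c.sum fun i r ↦ baseToSections (pullback.snd sX (specOver k K)) _ r *
    (pullback.fst sX (specOver k K)).app U (a i)

theorem exists_eq_baseChangeSection {U : X.Opens} (hU : IsAffineOpen U) (a : ℕ → Γ(X, U))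
    (ha : ∀ f : Γ(X, U), ∃ c : ℕ →₀ k, f = c.sum fun i r ↦ baseToSections sX U r * a i)
    (f : Γ(pullback sX (specOver k K), pullback.fst sX (specOver k K) ⁻¹ᵁ U)) :
    ∃ c : ℕ →₀ K, f = baseChangeSection sX K U a c := by
  have H := IsPullback.of_hasPullback sX (specOver k K)
  have hUY : pullback.fst sX (specOver k K) ⁻¹ᵁ U =
    pullback.fst sX (specOver k K) ⁻¹ᵁ U ⊓ pullback.snd sX (specOver k K) ⁻¹ᵁ ⊤ := by simp
  have h1 := isIso_pushoutSection_of_isAffineOpen H (US := ⊤) (UT := ⊤) le_top le_top hUY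
    (isAffineOpen_top _) (isAffineOpen_top _) hU
  have h2 := (isIso_pushoutSection_iff H _ _ hUY).1 h1
  obtain ⟨c, hc⟩ := CommRingCat.exists_sum_of_isPushout h2 a (fun x ↦ by
    obtain ⟨c, hc⟩ := ha x
    refine ⟨c.mapRange (Scheme.ΓSpecIso (.of k)).inv
      (map_zero (Scheme.ΓSpecIso (.of k)).inv.hom), ?_⟩
    rw [Finsupp.sum_mapRange_index (by simp)]
    exact hc) f
  refine ⟨c.mapRange (Scheme.ΓSpecIso (.of K)).hom (map_zero (Scheme.ΓSpecIso (.of K)).hom.hom), ?_⟩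
  rw [baseChangeSection, Finsupp.sum_mapRange_index (by simp), hc]
  refine Finset.sum_congr rfl fun i _ ↦ ?_
  rw [Scheme.Hom.app_eq_appLE]
  congr 1
  have := congr($((Scheme.ΓSpecIso (.of K)).hom_inv_id) (c i))
  exact this.symm

variable {K} in
theorem pointEval_baseChangeSection (U : X.Opens) (a : ℕ → Γ(X, U)) (c : ℕ →₀ K)
    (w : Spec (.of K) ⟶ pullback sX (specOver k K))
    (hw : w ≫ pullback.snd sX (specOver k K) = 𝟙 _)
    (h : w (specPt K) ∈ pullback.fst sX (specOver k K) ⁻¹ᵁ U)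
    (h' : (w ≫ pullback.fst sX (specOver k K)) (specPt K) ∈ U) :
    pointEval w _ h (baseChangeSection sX K U a c) =
      c.sum fun i r ↦ r * pointEval (w ≫ pullback.fst sX (specOver k K)) U h' (a i) := by
  have h2 (r : K) := pointEval_baseToSections (pullback.snd sX (specOver k K)) (RingHom.id K) w
    (hw.trans (Spec.map_id _).symm) _ h r
  rw [baseChangeSection, Finsupp.sum, map_sum]
  refine Finset.sum_congr rfl fun i _ ↦ ?_
  have h3 := pointEval_comp w (pullback.fst sX (specOver k K)) U _ le_rfl h' h (a i)
  rw [← Scheme.Hom.app_eq_appLE] at h3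
  rw [map_mul, h2, RingHom.id_apply]
  exact congr(c i * $h3.symm)

variable {K} in
/-- The `K`-linear relations satisfied by the functions `a i` along the orbit of `x`. -/
def IsOrbitRelation (G : Set (X ⟶ X)) (x : Spec (.of K) ⟶ X) (U : X.Opens) (a : ℕ → Γ(X, U))
    (c : ℕ →₀ K) : Prop :=
  ∀ g ∈ G, ∀ h : (x ≫ g) (specPt K) ∈ U, (c.sum fun i r ↦ r * pointEval (x ≫ g) U h (a i)) = 0

variable {K} in
theorem isOrbitRelation_iff {G : Set (X ⟶ X)} (hG : ∀ g ∈ G, g ≫ sX = sX)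
    {x : Spec (.of K) ⟶ X} (hx : x ≫ sX = specOver k K) (U : X.Opens) (a : ℕ → Γ(X, U))
    (c : ℕ →₀ K) :
    IsOrbitRelation G x U a c ↔ Disjoint (orbitInBaseChange X sX G K x)
      ((pullback sX (specOver k K)).basicOpen (baseChangeSection sX K U a c)) := by
  rw [Set.disjoint_left]
  constructor
  · rintro H p ⟨g, hg, w, hw, hw', q, rfl⟩
    change w q ∉ _
    rw [eq_specPt q]
    intro h
    have hp : w (specPt K) ∈ pullback.fst sX (specOver k K) ⁻¹ᵁ U := Scheme.basicOpen_le _ _ h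
    refine (mem_basicOpen_iff_pointEval w _ hp _).1 h ?_
    rw [pointEval_baseChangeSection sX U a c w hw' hp hp]
    simp only [hw]
    exact H g hg _
  · intro H g hg h
    have hxg : (x ≫ g) ≫ sX = 𝟙 _ ≫ specOver k K := by simp [hG g hg, hx]
    let w := pullback.lift (x ≫ g) (𝟙 _) hxg
    have hw : w ≫ pullback.fst sX (specOver k K) = x ≫ g := pullback.lift_fst _ _ _
    have hw' : w ≫ pullback.snd sX (specOver k K) = 𝟙 _ := pullback.lift_snd _ _ _
    have hp : w (specPt K) ∈ pullback.fst sX (specOver k K) ⁻¹ᵁ U := by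
      rw [← hw] at h
      exact h
    have := H ⟨g, hg, w, hw, hw', specPt K, rfl⟩
    have := not_not.1 ((mem_basicOpen_iff_pointEval w _ hp _).not.1 this)
    rw [pointEval_baseChangeSection sX U a c w hw' hp hp] at this
    simpa only [hw] using this

variable {K} in
/-- Orbit closures are determined by the linear relations along the orbits in affine charts. -/
theorem closure_orbitInBaseChange_eq_iff {G : Set (X ⟶ X)} (hG : ∀ g ∈ G, g ≫ sX = sX)
    {x y : Spec (.of K) ⟶ X} (hx : x ≫ sX = specOver k K) (hy : y ≫ sX = specOver k K)
    {A : Type*} (U : A → X.Opens) (hU : ∀ α, IsAffineOpen (U α)) (hcov : ∀ p, ∃ α, p ∈ U α)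
    (a : ∀ α, ℕ → Γ(X, U α))
    (ha : ∀ α (f : Γ(X, U α)), ∃ c : ℕ →₀ k,
      f = c.sum fun i r ↦ baseToSections sX (U α) r * a α i) :
    closure (orbitInBaseChange X sX G K x) = closure (orbitInBaseChange X sX G K y) ↔
      ∀ α c, IsOrbitRelation G x (U α) (a α) c ↔ IsOrbitRelation G y (U α) (a α) c := by
  have aux {x y : Spec (.of K) ⟶ X} (hx : x ≫ sX = specOver k K) (hy : y ≫ sX = specOver k K)
      (H : ∀ α c, IsOrbitRelation G y (U α) (a α) c → IsOrbitRelation G x (U α) (a α) c) :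
      orbitInBaseChange X sX G K x ⊆ closure (orbitInBaseChange X sX G K y) := by
    intro p hp
    rw [mem_closure_iff]
    intro O hO hpO
    obtain ⟨α, hα⟩ := hcov (pullback.fst sX (specOver k K) p)
    have : IsAffineHom (specOver k K) := by unfold specOver; infer_instance
    have : IsAffineHom (pullback.fst sX (specOver k K)) := 
      isAffineHom_isStableUnderBaseChange.of_isPullback
        (IsPullback.of_hasPullback sX (specOver k K)).flip this
    have hV : IsAffineOpen (pullback.fst sX (specOver k K) ⁻¹ᵁ U α) := (hU α).preimage _
    obtain ⟨f, hfO, hpf⟩ := hV.exists_basicOpen_le (V := ⟨O, hO⟩) ⟨p, hpO⟩ hα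
    obtain ⟨c, rfl⟩ := exists_eq_baseChangeSection sX K (hU α) (a α) (ha α) f
    by_contra! h
    have : IsOrbitRelation G y (U α) (a α) c := by
      rw [isOrbitRelation_iff sX hG hy, Set.disjoint_left]
      intro q hq hq'
      exact (h ▸ (⟨hfO hq', hq⟩ : q ∈ O ∩ _) : q ∈ (∅ : Set _))
    have := (isOrbitRelation_iff sX hG hx _ _ _).1 (H α c this)
    exact Set.disjoint_left.1 this hp hpf
  constructor
  · intro h α c
    have key (s : Set (pullback sX (specOver k K) : Scheme.{u}))
        (O : (pullback sX (specOver k K)).Opens) : Disjoint s O ↔ Disjoint (closure s) O :=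
      ⟨fun h ↦ h.closure_left O.2, fun h ↦ h.mono_left subset_closure⟩
    rw [isOrbitRelation_iff sX hG hx, isOrbitRelation_iff sX hG hy, key, h, ← key]
  · intro h
    exact subset_antisymm (closure_minimal (aux hx hy fun α c ↦ (h α c).2) isClosed_closure)
      (closure_minimal (aux hy hx fun α c ↦ (h α c).1) isClosed_closure)

end BaseChange

end AlgebraicGeometry

/-- A subfamily of a family of vectors which is a basis of the span of the whole family. -/
theorem exists_basis_subfamily (K : Type*) {V ι : Type*} [Field K] [AddCommGroup V] [Module K V]
    (v : ι → V) : ∃ J : Set ι, LinearIndependent K (fun j : J ↦ v j) ∧ ∃ l : ι → J →₀ K,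
      ∀ i, v i = ∑ j ∈ (l i).support, l i j • v j := by
  obtain ⟨J, -, -, hJ, hli⟩ := exists_linearIndepOn_extension (K := K) (v := v)
    (linearIndepOn_empty K v) (Set.subset_univ ∅)
  refine ⟨J, hli, ?_⟩
  have (i : ι) : ∃ l : J →₀ K, v i = ∑ j ∈ l.support, l j • v j := by
    have : v i ∈ Submodule.span K (v '' J) := hJ ⟨i, trivial, rfl⟩
    rw [Set.image_eq_range, Finsupp.mem_span_range_iff_exists_finsupp] at this
    obtain ⟨l, hl⟩ := this
    exact ⟨l, hl.symm⟩
  choose l hl using this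
  exact ⟨l, hl⟩

namespace AlgebraicGeometry

theorem exists_fieldPoint {X : Scheme.{u}} (p : X) :
    ∃ (K : Type u) (_ : Field K) (z : Spec (.of K) ⟶ X), z (specPt K) = p :=
  ⟨X.residueField p, inferInstance, X.fromSpecResidueField p, X.fromSpecResidueField_apply p _⟩

section Columns

variable {X : Scheme.{u}} {K : Type u} [Field K]

/-- The values of the section `a i` along the part of the orbit of `z` lying in `U`. -/
def column (G : Set (X ⟶ X)) (z : Spec (.of K) ⟶ X) (U : X.Opens) (a : ℕ → Γ(X, U)) (i : ℕ)
    (g : {g : X ⟶ X // g ∈ G ∧ (z ≫ g) (specPt K) ∈ U}) : K :=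
  pointEval (z ≫ g) U g.2.2 (a i)

theorem isOrbitRelation_iff_linearCombination (G : Set (X ⟶ X)) (z : Spec (.of K) ⟶ X)
    (U : X.Opens) (a : ℕ → Γ(X, U)) (c : ℕ →₀ K) :
    IsOrbitRelation G z U a c ↔ Finsupp.linearCombination K (column G z U a) c = 0 := by
  rw [funext_iff]
  simp only [Finsupp.linearCombination_apply, Finsupp.sum, Finset.sum_apply, Pi.smul_apply,
    Subtype.forall, forall_and_index]
  rfl

theorem linearIndependent_column_of_comp {G : Set (X ⟶ X)} (hG : ∀ g ∈ G, ∀ g' ∈ G, g ≫ g' ∈ G)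
    {g : X ⟶ X} (hg : g ∈ G) (z : Spec (.of K) ⟶ X) (U : X.Opens) (a : ℕ → Γ(X, U)) {J : Set ℕ}
    (h : LinearIndependent K fun j : J ↦ column G (z ≫ g) U a j) :
    LinearIndependent K fun j : J ↦ column G z U a j := by
  let e : {g' : X ⟶ X // g' ∈ G ∧ ((z ≫ g) ≫ g') (specPt K) ∈ U} →
      {g : X ⟶ X // g ∈ G ∧ (z ≫ g) (specPt K) ∈ U} :=
    fun g' ↦ ⟨g ≫ g', hG _ hg _ g'.2.1, by simpa only [Category.assoc] using g'.2.2⟩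
  refine LinearIndependent.of_comp (LinearMap.funLeft K K e) ?_
  convert h using 2 with j
  funext g'
  simp only [Function.comp_apply, LinearMap.funLeft_apply, column, e, Category.assoc]

theorem linearIndependent_column_specMap {L : Type u} [Field L] (G : Set (X ⟶ X))
    (z : Spec (.of K) ⟶ X) (σ : K →+* L) (U : X.Opens) (a : ℕ → Γ(X, U)) {J : Set ℕ}
    (h : LinearIndependent K fun j : J ↦ column G z U a j) :
    LinearIndependent L fun j : J ↦ column G (Spec.map (CommRingCat.ofHom σ) ≫ z) U a j := by
  have hpt (g : X ⟶ X) : ((Spec.map (CommRingCat.ofHom σ) ≫ z) ≫ g) (specPt L) =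
      (z ≫ g) (specPt K) := by rw [Category.assoc, specMap_apply_specPt]
  let e : {g : X ⟶ X // g ∈ G ∧ (z ≫ g) (specPt K) ∈ U} →
      {g : X ⟶ X // g ∈ G ∧ ((Spec.map (CommRingCat.ofHom σ) ≫ z) ≫ g) (specPt L) ∈ U} :=
    fun g ↦ ⟨g, g.2.1, by rw [hpt]; exact g.2.2⟩
  refine LinearIndependent.of_comp (LinearMap.funLeft L L e) ?_
  convert h.map_entries σ using 2 with j
  funext g
  simp only [Function.comp_apply, LinearMap.funLeft_apply, column, e, Category.assoc]
  exact pointEval_specMap _ _ _ g.2.2 _ _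

/-- The points at which the functions `a j`, `j ∈ J`, are linearly independent along the orbit. -/
def independenceLocus (G : Set (X ⟶ X)) (U : X.Opens) (a : ℕ → Γ(X, U)) (J : Set ℕ) : Set X :=
  {p | ∀ (K : Type u) [Field K] (z : Spec (.of K) ⟶ X), z (specPt K) = p →
    LinearIndependent K fun j : J ↦ column G z U a j}

theorem isOpen_independenceLocus (G : Set (X ⟶ X)) (U : X.Opens) (a : ℕ → Γ(X, U)) {J : Set ℕ}
    (hJ : J.Finite) : IsOpen (independenceLocus G U a J) := by
  classical
  have := hJ.fintype
  rw [isOpen_iff_forall_mem_open]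
  intro p hp
  obtain ⟨K, _, z, rfl⟩ := exists_fieldPoint p
  obtain ⟨γ, hγ⟩ := exists_det_ne_zero_of_linearIndependent (hp K z rfl)
  let V : X.Opens := ⟨⋂ s, ((γ s).1 ⁻¹ᵁ U : Set X),
    isOpen_iInter_of_finite fun s ↦ ((γ s).1 ⁻¹ᵁ U).2⟩
  have hV (s) : V ≤ (γ s).1 ⁻¹ᵁ U := fun x hx ↦ Set.mem_iInter.1 hx s
  let M : Matrix J J Γ(X, V) := .of fun s t ↦ (γ s).1.appLE U V (hV s) (a t)
  have hM {L : Type u} [Field L] (y : Spec (.of L) ⟶ X) (hy : y (specPt L) ∈ V) :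
      pointEval y V hy M.det = (Matrix.of fun s t : J ↦ column G y U a t
        ⟨(γ s).1, (γ s).2.1, hV s hy⟩).det := by
    rw [RingHom.map_det]
    congr 1
    ext s t
    exact (pointEval_comp y (γ s).1 U V (hV s) (hV s hy) hy (a t)).symm
  have hzV : z (specPt K) ∈ V := Set.mem_iInter.2 fun s ↦ (γ s).2.2
  refine ⟨X.basicOpen M.det, ?_, (X.basicOpen M.det).2, ?_⟩
  · rintro _ hq L _ y rfl
    have hy := X.basicOpen_le _ hq
    have := (mem_basicOpen_iff_pointEval y V hy _).1 hq
    rw [hM] at this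
    exact linearIndependent_of_det_ne_zero _ this
  · refine (mem_basicOpen_iff_pointEval z V hzV _).2 ?_
    rwa [hM]

theorem mem_independenceLocus_of_map_mem {G : Set (X ⟶ X)} (hG : ∀ g ∈ G, ∀ g' ∈ G, g ≫ g' ∈ G)
    {g : X ⟶ X} (hg : g ∈ G) (U : X.Opens) (a : ℕ → Γ(X, U)) {J : Set ℕ} {p : X}
    (h : g p ∈ independenceLocus G U a J) : p ∈ independenceLocus G U a J := by
  rintro K _ z rfl
  exact linearIndependent_column_of_comp hG hg z U a (h K (z ≫ g) rfl)

theorem genericPoint_mem_independenceLocus [IsIntegral X] {G : Set (X ⟶ X)} (U : X.Opens)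
    (a : ℕ → Γ(X, U)) {J : Set ℕ}
    (h : LinearIndependent X.functionField fun j : J ↦ column G (genPt X) U a j) :
    genericPoint X ∈ independenceLocus G U a J := by
  intro K _ z hz
  obtain ⟨σ, rfl⟩ := exists_specMap_comp_genPt z hz
  exact linearIndependent_column_specMap G _ σ U a h

/-- The coordinates of the columns at the generic point are invariant. -/
theorem coordinates_invariant [IsIntegral X] {G : Set (X ⟶ X)}
    (hG : ∀ g ∈ G, ∀ g' ∈ G, g ≫ g' ∈ G) {g : X ⟶ X} (hg : g ∈ G) (U : X.Opens)
    (a : ℕ → Γ(X, U)) {J : Set ℕ}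
    (hJ : LinearIndependent X.functionField fun j : J ↦ column G (genPt X) U a j)
    (l : ℕ → J →₀ X.functionField)
    (hl : ∀ i, column G (genPt X) U a i =
      ∑ j ∈ (l i).support, l i j • column G (genPt X) U a j)
    (σ : X.functionField →+* X.functionField)
    (hσ : genPt X ≫ g = Spec.map (CommRingCat.ofHom σ) ≫ genPt X) (i : ℕ) (j : J) :
    σ (l i j) = l i j := by
  by_cases hj : j ∈ (l i).support
  swap
  · rw [Finsupp.notMem_support_iff.1 hj, map_zero]
  refine sub_eq_zero.1 (linearIndependent_iff'.1 (hJ.map_entries σ) (l i).support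
    (fun j ↦ σ (l i j) - l i j) ?_ j hj)
  funext h
  have hpt : (genPt X ≫ g ≫ h) (specPt X.functionField) = (genPt X ≫ h.1) (specPt _) := by
    rw [← Category.assoc, hσ, Category.assoc, specMap_apply_specPt]
  let gh : {h : X ⟶ X // h ∈ G ∧ (genPt X ≫ h) (specPt X.functionField) ∈ U} :=
    ⟨g ≫ h, hG _ hg _ h.2.1, by rw [hpt]; exact h.2.2⟩
  have key (i : ℕ) : column G (genPt X) U a i gh = σ (column G (genPt X) U a i h) := by
    simp only [column, gh, ← pointEval_specMap (genPt X ≫ h.1) σ U h.2.2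
      (by rw [specMap_apply_specPt]; exact h.2.2)]
    simp only [← Category.assoc, hσ]
  have h1 := congrFun (hl i) gh
  have h2 := congrArg σ (congrFun (hl i) h)
  simp only [Finset.sum_apply, Pi.smul_apply, smul_eq_mul, key, map_sum, map_mul] at h1 h2
  simp only [Finset.sum_apply, Pi.smul_apply, smul_eq_mul, sub_mul, Finset.sum_sub_distrib,
    Pi.zero_apply]
  rw [← h1, ← h2, sub_self]

/-- The relations between the columns at the generic point specialize to those points where the
denominators of the coordinates do not vanish. -/
theorem column_eq_sum [IsIntegral X] {G : Set (X ⟶ X)} (U W : X.Opens) [Nonempty U]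
    (hgen : genPt X (specPt X.functionField) ∈ W) (hGdom : ∀ g ∈ G, IsDominant g)
    (a : ℕ → Γ(X, U)) {J : Set ℕ} (l : J →₀ X.functionField) (i : ℕ)
    (hl : column G (genPt X) U a i = ∑ j ∈ l.support, l j • column G (genPt X) U a j)
    (p q : J → Γ(X, W))
    (hpq : ∀ j, pointEval (genPt X) W hgen (q j) * l j = pointEval (genPt X) W hgen (p j))
    (z : Spec (.of K) ⟶ X) (hz : z (specPt K) ∈ W) (hq : ∀ j, pointEval z W hz (q j) ≠ 0) :
    column G z U a i = ∑ j ∈ l.support,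
      (pointEval z W hz (p j) / pointEval z W hz (q j)) • column G z U a j := by
  funext ⟨g, hg, hgz⟩
  have := hGdom g hg
  let V : X.Opens := W ⊓ g ⁻¹ᵁ U
  have hVW : V ≤ W := inf_le_left
  have hVU : V ≤ g ⁻¹ᵁ U := inf_le_right
  have hgU : (genPt X ≫ g) (specPt X.functionField) ∈ U := by
    rw [Scheme.Hom.comp_apply, genPt_specPt, map_genericPoint]
    exact genericPoint_mem U
  have hgV : genPt X (specPt X.functionField) ∈ V := ⟨hgen, hgU⟩
  have hzV : z (specPt K) ∈ V := ⟨hz, hgz⟩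
  have h1 := congrFun hl ⟨g, hg, hgU⟩
  simp only [Finset.sum_apply, Pi.smul_apply, smul_eq_mul, column] at h1 ⊢
  simp only [pointEval_comp (genPt X) g U V hVU hgU hgV] at h1
  simp only [pointEval_comp z g U V hVU hgz hzV, ← pointEval_map z W V hVW hz hzV]
  simp only [← pointEval_map (genPt X) W V hVW hgen hgV] at hpq
  simp only [← pointEval_map z W V hVW hz hzV] at hq
  exact specialize_relation (pointEval (genPt X) V hgV) (pointEval_genPt_injective V hgV)
    (pointEval z V hzV) l.support l _ _ _ _ (fun j _ ↦ hpq j) (fun j _ ↦ hq j) h1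

end Columns

end AlgebraicGeometry

/-- Elements of a field generated by the images of elements `c s` of a ring are fractions of
polynomials in the `c s`. -/
theorem exists_fraction_of_mem_adjoin {k F R : Type*} [Field k] [Field F] [CommRing R]
    [Algebra k F] (i : R →+* F) (β : k →+* R) (hβ : i.comp β = algebraMap k F) {S : Set F}
    (c : S → R) (hc : ∀ s, i (c s) = s) {t : F} (ht : t ∈ IntermediateField.adjoin k S) :
    ∃ p ∈ (eval₂Hom β c).range, ∃ q ∈ (eval₂Hom β c).range, i q ≠ 0 ∧ i q * t = i p := by
  have key : Algebra.adjoin k S = (aeval (R := k) ((↑) : S → F)).range := by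
    rw [← Algebra.adjoin_range_eq_range_aeval, Subtype.range_coe]
  have hi (P : MvPolynomial S k) : i (eval₂Hom β c P) = aeval (R := k) ((↑) : S → F) P := by
    rw [← RingHom.comp_apply, comp_eval₂Hom, hβ]
    simp only [hc]
    rfl
  obtain ⟨r, hr, s, hs, rfl⟩ := IntermediateField.mem_adjoin_iff_div.1 ht
  rw [key] at hr hs
  obtain ⟨P, rfl⟩ := hr
  obtain ⟨Q, rfl⟩ := hs
  by_cases hQ : aeval (R := k) ((↑) : S → F) Q = 0
  · refine ⟨0, zero_mem _, 1, one_mem _, by simp, ?_⟩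
    simp [hQ]
  · refine ⟨_, ⟨P, rfl⟩, _, ⟨Q, rfl⟩, by rwa [hi], ?_⟩
    rw [hi, hi]
    exact mul_div_cancel₀ _ hQ

namespace AlgebraicGeometry

section ToSpecSubring

variable {X : Scheme.{u}} (W : X.Opens) (B : Subring Γ(X, W))

/-- The morphism from an open subscheme to the spectrum of a ring of functions on it. -/
def toSpecSubring : (W : Scheme.{u}) ⟶ Spec (.of B) :=
  W.toSpecΓ ≫ Spec.map (CommRingCat.ofHom B.subtype)

variable {W} in
theorem isDominant_toSpecSubring (hW : IsAffineOpen W) : IsDominant (toSpecSubring W B) := by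
  have : IsIso W.toSpecΓ := by
    have : IsAffine W := hW
    rw [Scheme.Opens.toSpecΓ]
    infer_instance
  have : IsDominant (Spec.map (CommRingCat.ofHom B.subtype)) :=
    ⟨(PrimeSpectrum.denseRange_comap_iff_ker_le_nilRadical B.subtype).2 <| by
      rw [(RingHom.injective_iff_ker_eq_bot _).1 B.subtype_injective]
      exact bot_le⟩
  rw [toSpecSubring]
  infer_instance

theorem comp_toSpecSubring_eq_iff {K : Type u} [Field K] (x y : Spec (.of K) ⟶ W)
    (hx : (x ≫ W.ι) (specPt K) ∈ W) (hy : (y ≫ W.ι) (specPt K) ∈ W) :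
    x ≫ toSpecSubring W B = y ≫ toSpecSubring W B ↔
      ∀ b ∈ B, pointEval (x ≫ W.ι) W hx b = pointEval (y ≫ W.ι) W hy b := by
  rw [toSpecSubring, ← Category.assoc, ← Category.assoc, comp_opensToSpecΓ W x hx,
    comp_opensToSpecΓ W y hy, ← Spec.map_comp, ← Spec.map_comp, Spec.map_injective.eq_iff,
    CommRingCat.hom_ext_iff, RingHom.ext_iff, Subtype.forall]
  rfl

theorem toSpecSubring_comp_specMap {k : Type u} [Field k] (sX : X ⟶ Spec (.of k)) (β : k →+* B)
    (hβ : B.subtype.comp β = baseToSections sX W) :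
    toSpecSubring W B ≫ Spec.map (CommRingCat.ofHom β) = W.ι ≫ sX := by
  have h1 := Scheme.Opens.toSpecΓ_SpecMap_appLE sX ⊤ W le_top
  rw [toSpecSubring, Category.assoc, ← Spec.map_comp, ← CommRingCat.ofHom_comp, hβ]
  change _ ≫ Spec.map (_ ≫ _) = _
  rw [Spec.map_comp, ← Category.assoc, h1, Scheme.Opens.toSpecΓ_top, Category.assoc, Category.assoc,
    ← SpecMap_ΓSpecIso_hom, ← Spec.map_comp, Iso.inv_hom_id, Spec.map_id, Category.comp_id]
  exact Scheme.Hom.resLE_comp_ι _ _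

theorem exists_restrict_comp_toSpecSubring (g : X ⟶ X)
    (hB : ∀ b ∈ B, g.appLE W (W ⊓ g ⁻¹ᵁ W) inf_le_right b =
      X.presheaf.map (homOfLE inf_le_left : W ⊓ g ⁻¹ᵁ W ⟶ W).op b) :
    ∃ ψ : ((W ⊓ g ⁻¹ᵁ W : X.Opens) : Scheme.{u}) ⟶ W, ψ ≫ W.ι = (W ⊓ g ⁻¹ᵁ W).ι ≫ g ∧
      ψ ≫ toSpecSubring W B = X.homOfLE inf_le_left ≫ toSpecSubring W B := by
  refine ⟨g.resLE W (W ⊓ g ⁻¹ᵁ W) inf_le_right, Scheme.Hom.resLE_comp_ι _ _, ?_⟩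
  have h1 := Scheme.Opens.toSpecΓ_SpecMap_appLE g W (W ⊓ g ⁻¹ᵁ W) inf_le_right
  have h2 := Scheme.Opens.toSpecΓ_SpecMap_presheaf_map _ _ (inf_le_left : W ⊓ g ⁻¹ᵁ W ≤ W)
  rw [toSpecSubring, ← Category.assoc, ← Category.assoc, ← h1, ← h2, Category.assoc,
    Category.assoc, ← Spec.map_comp, ← Spec.map_comp]
  congr 2
  ext b
  exact hB b.1 b.2

end ToSpecSubring

section Quotient

variable {X : Scheme.{u}}

theorem mem_basicOpen_of_map_mem {g : X ⟶ X} {W : X.Opens} {b : Γ(X, W)}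
    (hb : g.appLE W (W ⊓ g ⁻¹ᵁ W) inf_le_right b =
      X.presheaf.map (homOfLE inf_le_left : W ⊓ g ⁻¹ᵁ W ⟶ W).op b) {p : X} (hp : p ∈ W)
    (h : g p ∈ X.basicOpen b) : p ∈ X.basicOpen b := by
  obtain ⟨K, _, z, rfl⟩ := exists_fieldPoint p
  have hgp : (z ≫ g) (specPt K) ∈ W := X.basicOpen_le b h
  have hV : z (specPt K) ∈ W ⊓ g ⁻¹ᵁ W := ⟨hp, hgp⟩
  rw [mem_basicOpen_iff_pointEval z W hp, ← pointEval_map z W _ inf_le_left hp hV]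
  have := (mem_basicOpen_iff_pointEval (z ≫ g) W hgp b).1 h
  rw [pointEval_comp z g W _ inf_le_right hgp hV] at this
  exact hb ▸ this

theorem linearIndependent_column_of_mem_independenceLocus {K : Type u} [Field K]
    (G : Set (X ⟶ X)) (z : Spec (.of K) ⟶ X) (U : X.Opens) (a : ℕ → Γ(X, U)) {J : Set ℕ}
    (h : ∀ s : Finset J, z (specPt K) ∈ independenceLocus G U a (Subtype.val '' (s : Set J))) :
    LinearIndependent K fun j : J ↦ column G z U a j := by
  rw [linearIndependent_iff_finset_linearIndependent]
  intro s
  exact (h s K z rfl).comp (fun j : s ↦ ⟨j.1.1, j.1, j.2, rfl⟩) fun i j hij ↦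
    Subtype.ext (Subtype.ext congr($(hij).1))

variable {k : Type u} [Field k] [IsIntegral X] (sX : X ⟶ Spec (.of k))

theorem appLE_eq_map_of_mem_range {g : X ⟶ X} [IsDominant g] (hg : g ≫ sX = sX) (W : X.Opens)
    (hgen : genPt X (specPt X.functionField) ∈ W) {S : Set X.functionField} (c : S → Γ(X, W))
    (hc : ∀ s, pointEval (genPt X) W hgen (c s) = s) (σ : X.functionField →+* X.functionField)
    (hσ : genPt X ≫ g = Spec.map (CommRingCat.ofHom σ) ≫ genPt X) (hS : ∀ s ∈ S, σ s = s)
    (b : Γ(X, W)) (hb : b ∈ (eval₂Hom (baseToSections sX W) c).range) :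
    g.appLE W (W ⊓ g ⁻¹ᵁ W) inf_le_right b =
      X.presheaf.map (homOfLE inf_le_left : W ⊓ g ⁻¹ᵁ W ⟶ W).op b := by
  obtain ⟨P, rfl⟩ := hb
  have hgW : (genPt X ≫ g) (specPt X.functionField) ∈ W := by
    rw [hσ, specMap_apply_specPt]
    exact hgen
  have hgV : genPt X (specPt X.functionField) ∈ W ⊓ g ⁻¹ᵁ W := ⟨hgen, hgW⟩
  suffices (g.appLE W (W ⊓ g ⁻¹ᵁ W) inf_le_right).hom.comp
      (eval₂Hom (baseToSections sX W) c) =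
      (X.presheaf.map (homOfLE inf_le_left : W ⊓ g ⁻¹ᵁ W ⟶ W).op).hom.comp
      (eval₂Hom (baseToSections sX W) c) from congr($this P)
  refine MvPolynomial.ringHom_ext (fun r ↦ ?_) fun s ↦ ?_
  · simp only [RingHom.comp_apply, eval₂Hom_C]
    exact (appLE_baseToSections sX g hg W _ inf_le_right r).trans
      (map_baseToSections sX W _ inf_le_left r).symm
  · simp only [RingHom.comp_apply, eval₂Hom_X']
    refine pointEval_genPt_injective _ hgV ?_
    refine (pointEval_comp (genPt X) g W _ inf_le_right hgW hgV _).symm.trans ?_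
    refine Eq.trans ?_ (pointEval_map (genPt X) W _ inf_le_left hgen hgV _).symm
    rw [hc]
    simp only [hσ]
    rw [pointEval_specMap _ _ _ hgen, hc, hS _ s.2]

theorem forall_pointEval_eq_iff_isOrbitRelation_iff {G : Set (X ⟶ X)}
  (hGdom : ∀ g ∈ G, IsDominant g) {K : Type u} [Field K] [Algebra k K]
  {A : Type*} (U : A → X.Opens) [∀ α, Nonempty (U α)] (a : ∀ α, ℕ → Γ(X, U α)) (J : A → Set ℕ)
  (l : ∀ α, ℕ → J α →₀ X.functionField)
  (hl : ∀ α i, column G (genPt X) (U α) (a α) i =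
      ∑ j ∈ (l α i).support, l α i j • column G (genPt X) (U α) (a α) j)
  (W : X.Opens) (hgen : genPt X (specPt X.functionField) ∈ W) {S : Set X.functionField}
  (hS : ∀ s ∈ S, ∃ α i j, s = l α i j)
  (c : S → Γ(X, W)) (hc : ∀ s, pointEval (genPt X) W hgen (c s) = s)
  (p q : ∀ α, ℕ → J α → Γ(X, W))
  (hp : ∀ α i j, p α i j ∈ (eval₂Hom (baseToSections sX W) c).range)
  (hq : ∀ α i j, q α i j ∈ (eval₂Hom (baseToSections sX W) c).range)
  (hpq : ∀ α i j, pointEval (genPt X) W hgen (q α i j) * l α i j =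
    pointEval (genPt X) W hgen (p α i j))
    {x y : Spec (.of K) ⟶ X}
    (hx : x ≫ sX = specOver k K) (hy : y ≫ sX = specOver k K)
    (hxW : x (specPt K) ∈ W) (hyW : y (specPt K) ∈ W)
    (hxq : ∀ α i j, pointEval x W hxW (q α i j) ≠ 0)
    (hyq : ∀ α i j, pointEval y W hyW (q α i j) ≠ 0)
    (hxJ : ∀ α, LinearIndependent K fun j : J α ↦ column G x (U α) (a α) j)
    (hyJ : ∀ α, LinearIndependent K fun j : J α ↦ column G y (U α) (a α) j) :
    (∀ b ∈ (eval₂Hom (baseToSections sX W) c).range,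
      pointEval x W hxW b = pointEval y W hyW b) ↔
    ∀ α r, IsOrbitRelation G x (U α) (a α) r ↔ IsOrbitRelation G y (U α) (a α) r := by
  have key (α) := relations_eq_iff_coords_eq (hxJ α) (hyJ α) (fun i ↦ (l α i).support) _ _
    (fun i ↦ column_eq_sum (U α) W hgen hGdom (a α) (l α i) i (hl α i) (p α i) (q α i) (hpq α i)
      x hxW (hxq α i))
    (fun i ↦ column_eq_sum (U α) W hgen hGdom (a α) (l α i) i (hl α i) (p α i) (q α i) (hpq α i)
      y hyW (hyq α i))
  simp only [isOrbitRelation_iff_linearCombination, key]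
  constructor
  · intro H α i j _
    rw [H _ (hp α i j), H _ (hq α i j)]
  · rintro H _ ⟨P, rfl⟩
    suffices (pointEval x W hxW).comp (eval₂Hom (baseToSections sX W) c) =
      (pointEval y W hyW).comp (eval₂Hom (baseToSections sX W) c) from congr($this P)
    refine MvPolynomial.ringHom_ext (fun r ↦ ?_) fun s ↦ ?_
    · simp only [RingHom.comp_apply, eval₂Hom_C]
      rw [pointEval_baseToSections sX (algebraMap k K) x hx,
        pointEval_baseToSections sX (algebraMap k K) y hy]
    · simp only [RingHom.comp_apply, eval₂Hom_X']
      obtain ⟨α, i, j, hs⟩ := hS s s.2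
      by_cases hj : j ∈ (l α i).support
      · have hcs : q α i j * c s = p α i j := by
          refine pointEval_genPt_injective W hgen ?_
          rw [map_mul, hc, hs, hpq]
        have h1 := H α i j hj
        rwa [← hcs, map_mul, map_mul, mul_div_cancel_left₀ _ (hxq α i j),
          mul_div_cancel_left₀ _ (hyq α i j)] at h1
      · have hcs : c s = 0 := by
          refine pointEval_genPt_injective W hgen ?_
          rw [map_zero, hc, hs, Finsupp.notMem_support_iff.1 hj]
        rw [hcs, map_zero, map_zero]

end Quotient

end AlgebraicGeometry

/-- **Dynamical version of Rosenlicht's theorem, parts (a) and (b) (Theorem 1.2(a),(b)).**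
Let `k` be a field, `X` an irreducible quasi-projective variety over `k` and `G` a nonempty
semigroup of dominant `k`-morphisms `X → X`.  Then there exist a dense open subscheme
`X₀ ⊆ X`, a countable family `(Yᵢ)` of proper closed `G`-invariant subsets of `X₀`, an
integral `k`-scheme `Z` of finite type, and a dominant `k`-morphism `φ : X₀ → Z` such that:
(a) `φ ∘ g = φ` on `X₀ ∩ g⁻¹(X₀)` for every `g ∈ G`; and
(b) for every field extension `K/k` and all `K`-points `x, y` of `X` factoring through `X₀`
and avoiding every `Yᵢ`, one has `φ ∘ x = φ ∘ y` if and only if the `G`-orbits of `x` and `y`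
have the same Zariski closure in `X_K`. -/
theorem dynamical_rosenlicht
    {k : Type u} [Field k]
    (X : Scheme.{u}) (sX : X ⟶ Spec (CommRingCat.of k))
    [IsIntegral X] [LocallyOfFiniteType sX] [QuasiCompact sX]
    (hqp : IsQuasiProjectiveOver X sX)
    (G : Set (X ⟶ X)) (hGne : G.Nonempty)
    (hGover : ∀ g ∈ G, g ≫ sX = sX)
    (hGdom : ∀ g ∈ G, IsDominant g)
    (hGcomp : ∀ g ∈ G, ∀ g' ∈ G, g ≫ g' ∈ G) :
    ∃ (X₀ : X.Opens) (_ : Dense (X₀ : Set X)) (Y : ℕ → Set X)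
      (Z : Scheme.{u}) (sZ : Z ⟶ Spec (CommRingCat.of k))
      (_ : IsIntegral Z) (_ : LocallyOfFiniteType sZ) (_ : QuasiCompact sZ)
      (φ : (X₀ : Scheme.{u}) ⟶ Z) (_ : IsDominant φ) (_ : φ ≫ sZ = X₀.ι ≫ sX),
      -- each `Yᵢ` is a proper closed subset of `X₀` …
      (∀ i, Y i ⊆ (X₀ : Set X)) ∧
      (∀ i, IsClosed (Subtype.val ⁻¹' (Y i) : Set (X₀ : Set X))) ∧
      (∀ i, Y i ≠ (X₀ : Set X)) ∧
      -- … which is `G`-invariant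
      (∀ i, ∀ g ∈ G, ∀ p ∈ Y i, g.base p ∈ (X₀ : Set X) → g.base p ∈ Y i) ∧
      -- (a) `φ ∘ g = φ` on the dense open set `X₀ ∩ g⁻¹(X₀)`
      (∀ g ∈ G, ∃ ψ : ((X₀ ⊓ g ⁻¹ᵁ X₀ : X.Opens) : Scheme.{u}) ⟶ (X₀ : Scheme.{u}),
        ψ ≫ X₀.ι = (X₀ ⊓ g ⁻¹ᵁ X₀ : X.Opens).ι ≫ g ∧
        ψ ≫ φ = X.homOfLE inf_le_left ≫ φ) ∧
      -- (b) `φ` separates orbit closures of very general `K`-points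
      (∀ (K : Type u) [Field K] [Algebra k K]
        (x y : Spec (CommRingCat.of K) ⟶ X)
        (x₀ y₀ : Spec (CommRingCat.of K) ⟶ (X₀ : Scheme.{u})),
        x ≫ sX = specOver k K → y ≫ sX = specOver k K →
        x₀ ≫ X₀.ι = x → y₀ ≫ X₀.ι = y →
        (∀ i, ∀ p ∈ Set.range x.base, p ∉ Y i) →
        (∀ i, ∀ p ∈ Set.range y.base, p ∉ Y i) →
        (x₀ ≫ φ = y₀ ≫ φ ↔
          closure (orbitInBaseChange X sX G K x) =
            closure (orbitInBaseChange X sX G K y))) := by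
  classical
  obtain ⟨U, hUaff, hUne, hUcov⟩ := exists_nat_affine_cover sX
  choose a ha using fun α ↦ exists_nat_spanning sX (hUaff α)
  choose J hJ l hl using fun α ↦
    exists_basis_subfamily X.functionField (column G (genPt X) (U α) (a α))
  let _ : Algebra k X.functionField :=
    ((algebraMap Γ(X, U 0) X.functionField).comp (baseToSections sX (U 0))).toAlgebra
  have hess : Algebra.EssFiniteType k X.functionField := essFiniteType_functionField sX (hUaff 0)
  let T : Set X.functionField := {t | ∃ α i j, t = l α i j}
  obtain ⟨S, hST, hTS⟩ := exists_finset_subset_adjoin k T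
  obtain ⟨W, hW, hgen, hreg⟩ := exists_affine_forall_regular S
  choose c hc using fun s : (S : Set X.functionField) ↦ hreg s s.2
  have hbase : (pointEval (genPt X) W hgen).comp (baseToSections sX W) =
      algebraMap k X.functionField := by
    ext r
    have hV : genPt X (specPt X.functionField) ∈ W ⊓ U 0 := ⟨hgen, genPt_mem (U 0)⟩
    rw [RingHom.comp_apply, ← pointEval_map (genPt X) W _ inf_le_left hgen hV, map_baseToSections,
      ← map_baseToSections sX (U 0) _ inf_le_right,
      pointEval_map (genPt X) (U 0) _ inf_le_right (genPt_mem (U 0)) hV, pointEval_genPt]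
    rfl
  choose p hp q hq hq0 hpq using fun α i j ↦ exists_fraction_of_mem_adjoin
    (pointEval (genPt X) W hgen) (baseToSections sX W) hbase c hc (hTS ⟨α, i, j, rfl⟩)
  let Φ := eval₂Hom (baseToSections sX W) c
  have hinv (g) (hg : g ∈ G) (b) (hb : b ∈ Φ.range) :
      g.appLE W (W ⊓ g ⁻¹ᵁ W) inf_le_right b =
        X.presheaf.map (homOfLE inf_le_left : W ⊓ g ⁻¹ᵁ W ⟶ W).op b := by
    have := hGdom g hg
    obtain ⟨σ, hσ⟩ := exists_specMap_eq_genPt_comp g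
    refine appLE_eq_map_of_mem_range sX (hGover g hg) W hgen c hc σ hσ (fun s hs ↦ ?_) b hb
    obtain ⟨α, i, j, rfl⟩ := hST hs
    exact coordinates_invariant hGcomp hg (U α) (a α) (hJ α) (l α) (hl α) σ hσ i j
  let I := (Σ α, ℕ × J α) ⊕ (Σ α, Finset (J α))
  let O : I → X.Opens := Sum.elim (fun s ↦ X.basicOpen (q s.1 s.2.1 s.2.2)) fun s ↦
    ⟨independenceLocus G (U s.1) (a s.1) (Subtype.val '' (s.2 : Set (J s.1))),
      isOpen_independenceLocus G _ _ (s.2.finite_toSet.image _)⟩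
  have hOgen (s : I) : genericPoint X ∈ O s := by
    obtain ⟨α, i, j⟩ | ⟨α, s⟩ := s
    · rw [← genPt_specPt]
      exact (mem_basicOpen_iff_pointEval _ W hgen _).2 (hq0 α i j)
    · refine genericPoint_mem_independenceLocus (U α) (a α) ?_
      exact LinearIndepOn.mono (s := J α) (hJ α) (by simp)
  have hOinv (s : I) (g) (hg : g ∈ G) (x) (hx : x ∈ W) (h : g x ∈ O s) : x ∈ O s := by
    obtain ⟨α, i, j⟩ | ⟨α, s⟩ := s
    · exact mem_basicOpen_of_map_mem (hinv g hg _ (hq α i j)) hx h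
    · exact mem_independenceLocus_of_map_mem hGcomp hg _ _ h
  have : Nonempty W := ⟨_, hgen⟩
  have hgW : genericPoint X ∈ W := genPt_specPt X ▸ hgen
  have : Nonempty I := ⟨.inr ⟨0, ∅⟩⟩
  obtain ⟨e, he⟩ := exists_surjective_nat I
  have hβ : Φ.range.subtype.comp (Φ.rangeRestrict.comp C) = baseToSections sX W := by
    ext r
    exact eval₂Hom_C _ _ r
  have : IsDomain (CommRingCat.of Φ.range) := inferInstanceAs (IsDomain Φ.range)
  refine ⟨W, W.2.dense ⟨_, hgW⟩, fun i ↦ W \ O (e i), Spec (.of Φ.range),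
    Spec.map (CommRingCat.ofHom (Φ.rangeRestrict.comp C)), inferInstance, ?_, inferInstance,
    toSpecSubring W Φ.range, isDominant_toSpecSubring _ hW, toSpecSubring_comp_specMap W _ sX _ hβ,
    fun i ↦ Set.sdiff_subset, fun i ↦ ?_, fun i h ↦ ?_, fun i g hg x hx hgx ↦ ?_, fun g hg ↦ ?_, ?_⟩
  · refine (HasRingHomProperty.Spec_iff (P := @LocallyOfFiniteType)).2 ?_
    exact (RingHom.FiniteType.of_surjective _ Φ.rangeRestrict_surjective).comp
      (RingHom.finiteType_algebraMap.2 inferInstance)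
  · have : (Subtype.val ⁻¹' (W \ O (e i)) : Set (W : Set X)) = (Subtype.val ⁻¹' (O (e i)))ᶜ := by
      ext x
      simp
    rw [this]
    exact ((O (e i)).2.preimage continuous_subtype_val).isClosed_compl
  · exact (h.ge hgW).2 (hOgen _)
  · exact ⟨hgx, fun h ↦ hx.2 (hOinv _ g hg x hx.1 h)⟩
  · exact exists_restrict_comp_toSpecSubring W _ g (hinv g hg)
  rintro K _ _ _ _ x y hx hy rfl rfl hxY hyY
  have hmem (z : Spec (.of K) ⟶ W) : (z ≫ W.ι) (specPt K) ∈ W := (z (specPt K)).2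
  have good (z : Spec (.of K) ⟶ W) (hz : ∀ i, ∀ p ∈ Set.range (z ≫ W.ι), p ∉ (W \ O (e i) : Set X))
      (s : I) : (z ≫ W.ι) (specPt K) ∈ O s := by
    obtain ⟨i, rfl⟩ := he s
    by_contra h
    exact hz i _ ⟨specPt K, rfl⟩ ⟨hmem z, h⟩
  rw [comp_toSpecSubring_eq_iff W _ x y (hmem x) (hmem y),
    closure_orbitInBaseChange_eq_iff sX hGover hx hy U hUaff hUcov a ha]
  have hqne (z : Spec (.of K) ⟶ W) (hz) (α i j) :=
    (mem_basicOpen_iff_pointEval (z ≫ W.ι) W (hmem z) _).1 (good z hz (.inl ⟨α, i, j⟩))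
  have hind (z : Spec (.of K) ⟶ W) (hz) (α) :=
    linearIndependent_column_of_mem_independenceLocus G (z ≫ W.ι) (U α) (a α)
      fun s ↦ good z hz (.inr ⟨α, s⟩)
  exact forall_pointEval_eq_iff_isOrbitRelation_iff sX hGdom U a J l hl W hgen
    (fun s hs ↦ hST hs) c hc p q hp hq hpq hx hy (hmem x) (hmem y)
    (hqne x hxY) (hqne y hyY) (hind x hxY) (hind y hyY)

end
end

section
/- Let k be a field, X an integral scheme of finite type over k, V a scheme of finite type over k, and π : V → X a k-morphism. Let (U_λ, s_λ)_{λ ∈ Λ} be a family (of arbitrary cardinality) of rational sections of π, i.e. each U_λ ⊆ X is a dense open subscheme and s_λ : U_λ → V is a k-morphism with π ∘ s_λ equal to the inclusion U_λ ↪ X. Assume that the union over all λ ∈ Λ of the images s_λ(U_λ) is Zariski dense in V. Then there exists a countable collection (Yᵢ)_{i≥1} of proper closed subsets of X with the following property: for every field extension K/k and every K-point x : Spec K → X that factors through U_λ for every λ ∈ Λ and whose image avoids every Yᵢ, the set of K-points {s_λ ∘ x : λ ∈ Λ} of the fiber V_x := V ×_X Spec K (fiber product along π and x) is Zariski dense in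 V_x. -/
universe u v

open AlgebraicGeometry CategoryTheory CategoryTheory.Limits

open scoped TensorProduct

theorem LinearIndepOn.exists_finsupp_sum_eq_single {ι Λ L : Type*} [Field L] [DecidableEq ι]
    {v : ι → Λ → L} {J : Finset ι} (hv : LinearIndepOn L v (J : Set ι)) (i : J) :
    ∃ a : Λ →₀ L, ∀ j : J, (a.sum fun l c => c * v j l) = Pi.single (M := fun _ : J => L) i 1 j := by
  have htop : Submodule.span L (Set.range fun (l : Λ) (j : J) => v j l) = ⊤ := by
    by_contra h
    obtain ⟨f, hf, hle⟩ := Submodule.exists_le_ker_of_lt_top _ (lt_top_iff_ne_top.mpr h)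
    apply hf
    have key : ∀ j : J, f (Pi.single j 1) = 0 := by
      refine Fintype.linearIndependent_iff.mp hv (fun j => f (Pi.single j 1)) ?_
      funext l
      have h0 : f (fun j : J => v j l) = 0 := hle (Submodule.subset_span ⟨l, rfl⟩)
      rw [LinearMap.pi_apply_eq_sum_univ] at h0
      simp only [Finset.sum_apply, Pi.smul_apply, smul_eq_mul, Pi.zero_apply]
      rw [← h0]
      refine Finset.sum_congr rfl fun j _ => ?_
      rw [smul_eq_mul, mul_comm]
      congr 2
      funext j'
      simp [Pi.single_apply, eq_comm]
    exact LinearMap.pi_ext' fun j => LinearMap.ext_ring (by simpa using key j)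
  have hmem : (Pi.single i 1 : J → L) ∈
      Submodule.span L (Set.range fun (l : Λ) (j : J) => v j l) := htop ▸ trivial
  obtain ⟨a, ha⟩ := Finsupp.mem_span_range_iff_exists_finsupp.mp hmem
  refine ⟨a, fun j => ?_⟩
  rw [← ha, Finsupp.sum_apply']
  simp [Finsupp.sum]

theorem LinearIndepOn.exists_integral_dual {ι Λ R L : Type*} [CommRing R] [IsDomain R] [Field L]
    [Algebra R L] [IsFractionRing R L] [DecidableEq ι]
    {v : ι → Λ → L} {J : Finset ι} (hv : LinearIndepOn L v (J : Set ι)) (i : J) :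
    ∃ (T : Finset Λ) (m : R) (r : Λ → R) (n : ι → Λ → R), m ≠ 0 ∧
      (∀ j ∈ J, ∀ l ∈ T, algebraMap R L m * v j l = algebraMap R L (n j l)) ∧
      ∀ j : J, ∑ l ∈ T, r l * n j l = Pi.single (M := fun _ : J => R) i (m ^ 2) j := by
  obtain ⟨a, ha⟩ := hv.exists_finsupp_sum_eq_single i
  obtain ⟨m₁, h₁⟩ := IsLocalization.exist_integer_multiples (nonZeroDivisors R) a.support a
  obtain ⟨m₂, h₂⟩ := IsLocalization.exist_integer_multiples (nonZeroDivisors R)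
    (J ×ˢ a.support) fun p => v p.1 p.2
  let m : R := m₁ * m₂
  have hm : m ≠ 0 := nonZeroDivisors.ne_zero (m₁ * m₂).2
  have hr : ∀ l : Λ, ∃ r : R, l ∈ a.support → algebraMap R L r = algebraMap R L m * a l := by
    intro l
    by_cases hl : l ∈ a.support
    · obtain ⟨r, hr⟩ := h₁ l hl
      refine ⟨m₂ * r, fun _ => ?_⟩
      simp only [m, map_mul, hr, Algebra.smul_def]
      ring
    · exact ⟨0, fun h => (hl h).elim⟩
  have hn : ∀ (j : ι) (l : Λ), ∃ n : R, j ∈ J → l ∈ a.support →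
      algebraMap R L m * v j l = algebraMap R L n := by
    intro j l
    by_cases hl : j ∈ J ∧ l ∈ a.support
    · obtain ⟨r, hr⟩ := h₂ (j, l) (Finset.mem_product.mpr hl)
      refine ⟨m₁ * r, fun _ _ => ?_⟩
      simp only [m, map_mul, hr, Algebra.smul_def]
      ring
    · exact ⟨0, fun h h' => (hl ⟨h, h'⟩).elim⟩
  choose r hr using hr
  choose n hn using hn
  refine ⟨a.support, m, r, n, hm, fun j hj l hl => hn j l hj hl, fun j => ?_⟩
  apply IsFractionRing.injective R L
  have : algebraMap R L (Pi.single (M := fun _ : J => R) i (m ^ 2) j) =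
      algebraMap R L (m ^ 2) * Pi.single (M := fun _ : J => L) i 1 j := by
    simp only [Pi.single_apply]; split_ifs <;> simp
  rw [this, ← ha j, Finsupp.sum, map_sum, Finset.mul_sum]
  refine Finset.sum_congr rfl fun l hl => ?_
  rw [map_mul, hr l hl, ← hn j l j.2 hl, map_pow]
  ring

theorem Algebra.FiniteType.exists_countable_span_eq_top (R A : Type*) [CommRing R] [CommRing A]
    [Algebra R A] [Algebra.FiniteType R A] :
    ∃ b : ℕ → A, Submodule.span R (Set.range b) = ⊤ := by
  obtain ⟨n, f, hf⟩ := Algebra.FiniteType.iff_quotient_mvPolynomial''.mp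
    (inferInstance : Algebra.FiniteType R A)
  obtain ⟨e, he⟩ := exists_surjective_nat (Fin n →₀ ℕ)
  refine ⟨fun i => f (MvPolynomial.basisMonomials (Fin n) R (e i)), ?_⟩
  have : (Set.range fun i => f (MvPolynomial.basisMonomials (Fin n) R (e i))) =
      f.toLinearMap '' Set.range (MvPolynomial.basisMonomials (Fin n) R) := by
    rw [← Set.range_comp]
    exact he.range_comp (fun i => f (MvPolynomial.basisMonomials (Fin n) R i))
  rw [this, Submodule.span_image, Module.Basis.span_eq, Submodule.map_top,
    LinearMap.range_eq_top.mpr hf]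

/-- If the homomorphisms `ψ l` to the fraction field separate the elements of `A` up to nilpotents,
then countably many of them do so after any specialization `R → K` avoiding countably many
nonzero elements of `R`. -/
theorem exists_countable_isNilpotent_of_specialization {R A L : Type*} [CommRing R] [IsDomain R]
    [Field L] [Algebra R L] [IsFractionRing R L] [CommRing A] [Algebra R A]
    [Algebra.FiniteType R A] {Λ : Type*} (ψ : Λ → A →ₐ[R] L)
    (hψ : ∀ a, (∀ l, ψ l a = 0) → IsNilpotent a) :
    ∃ (T : Set Λ) (C : Set R), T.Countable ∧ C.Countable ∧ (0 : R) ∉ C ∧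
      ∀ (K : Type u) [Field K] [Algebra R K], (∀ c ∈ C, algebraMap R K c ≠ 0) →
        ∀ χ : T → A →ₐ[R] K,
          (∀ (l : T) (a : A) (m n : R), algebraMap R L m * ψ l a = algebraMap R L n →
            algebraMap R K m * χ l a = algebraMap R K n) →
          ∀ f : K ⊗[R] A, (∀ l, Algebra.TensorProduct.lift (Algebra.ofId K K) (χ l)
            (fun _ _ => .all _ _) f = 0) → IsNilpotent f := by
  classical
  obtain ⟨b, hb⟩ := Algebra.FiniteType.exists_countable_span_eq_top R A
  let v : ℕ → Λ → L := fun i l => ψ l (b i)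
  obtain ⟨I, -, -, hspan, hI⟩ := exists_linearIndepOn_extension
    (linearIndepOn_empty L v) (Set.empty_subset Set.univ)
  have hrel : ∀ i, ∃ (c : R) (r : ℕ →₀ R), c ≠ 0 ∧ (r.support : Set ℕ) ⊆ I ∧
      IsNilpotent (c • b i - Finsupp.linearCombination R b r) := by
    intro i
    obtain ⟨y, hyI, hy⟩ := (Finsupp.mem_span_image_iff_linearCombination L).mp
      (hspan ⟨i, trivial, rfl⟩)
    obtain ⟨c, hc⟩ := IsLocalization.exist_integer_multiples (nonZeroDivisors R) y.support y
    choose! r hr using hc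
    let r' : ℕ →₀ R := Finsupp.onFinset y.support (fun j => if j ∈ y.support then r j else 0)
      (by intro j; split_ifs with h <;> simp_all)
    refine ⟨c, r', nonZeroDivisors.ne_zero c.2, ?_, hψ _ fun l => ?_⟩
    · refine Set.Subset.trans ?_ hyI
      exact_mod_cast Finsupp.support_onFinset_subset
    · have hyl := congrFun hy l
      rw [Finsupp.linearCombination_apply, Finsupp.sum, Finset.sum_apply] at hyl
      rw [map_sub, map_smul, Finsupp.linearCombination_apply,
        Finsupp.onFinset_sum _ (by simp), map_sum]
      rw [show ψ l (b i) = v i l from rfl, ← hyl, Finset.smul_sum, sub_eq_zero]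
      refine Finset.sum_congr rfl fun j hj => ?_
      rw [if_pos hj, map_smul, Algebra.smul_def (r j), hr j hj, Pi.smul_apply, smul_eq_mul,
        smul_mul_assoc]
  choose c r hc hrI hcr using hrel
  have hdual : ∀ p : Σ J : Finset ℕ, J, ∃ (T : Finset Λ) (m : R) (r : Λ → R) (n : ℕ → Λ → R),
      m ≠ 0 ∧ ((p.1 : Set ℕ) ⊆ I →
      (∀ j ∈ p.1, ∀ l ∈ T, algebraMap R L m * v j l = algebraMap R L (n j l)) ∧
      ∀ j : p.1, ∑ l ∈ T, r l * n j l = Pi.single (M := fun _ : p.1 => R) p.2 (m ^ 2) j) := by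
    intro p
    by_cases h : (p.1 : Set ℕ) ⊆ I
    · obtain ⟨T, m, r, n, hm, h'⟩ := (hI.mono h).exists_integral_dual (R := R) p.2
      exact ⟨T, m, r, n, hm, fun _ => h'⟩
    · exact ⟨∅, 1, 0, 0, one_ne_zero, fun h' => (h h').elim⟩
  choose T m q n hm hdual using hdual
  refine ⟨⋃ p, (T p : Set Λ), Set.range c ∪ Set.range m,
    Set.countable_iUnion fun p => (T p).countable_toSet,
    (Set.countable_range c).union (Set.countable_range m), ?_, ?_⟩
  · rintro (⟨i, hi⟩ | ⟨p, hp⟩)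
    · exact hc i hi
    · exact hm p hp
  intro K _ _ hC χ hχ f hf
  -- modulo the nilradical, `f` is a combination of the `b i` with `i ∈ I`
  obtain ⟨y, hyI, hy⟩ : ∃ y : ℕ →₀ K, (y.support : Set ℕ) ⊆ I ∧
      IsNilpotent (f - Finsupp.linearCombination K (fun i => (1 : K) ⊗ₜ[R] b i) y) := by
    let π := Ideal.Quotient.mkₐ K (nilradical (K ⊗[R] A))
    have hπ : ∀ z, π z = 0 ↔ IsNilpotent z := fun z => by
      simp [π, Ideal.Quotient.eq_zero_iff_mem, mem_nilradical]
    have hbs : ∀ i, π ((1 : K) ⊗ₜ[R] b i) ∈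
        Submodule.span K ((fun i => π ((1 : K) ⊗ₜ[R] b i)) '' I) := by
      intro i
      have h0 := (hcr i).map (Algebra.TensorProduct.includeRight : A →ₐ[R] K ⊗[R] A)
      rw [← hπ, map_sub, map_sub, sub_eq_zero] at h0
      have h1 : algebraMap R K (c i) ≠ 0 := hC _ (.inl ⟨i, rfl⟩)
      have h2 : algebraMap R K (c i) • π ((1 : K) ⊗ₜ[R] b i) ∈
          Submodule.span K ((fun i => π ((1 : K) ⊗ₜ[R] b i)) '' I) := by
        have h3 : algebraMap R K (c i) • π ((1 : K) ⊗ₜ[R] b i) =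
            π (Algebra.TensorProduct.includeRight (c i • b i)) := by
          rw [← map_smul, map_smul (Algebra.TensorProduct.includeRight : A →ₐ[R] K ⊗[R] A),
            algebraMap_smul]; rfl
        rw [h3, h0, Finsupp.linearCombination_apply, Finsupp.sum, map_sum, map_sum]
        refine Submodule.sum_mem _ fun j hj => ?_
        rw [map_smul, ← algebraMap_smul K, map_smul]
        exact Submodule.smul_mem _ _ (Submodule.subset_span ⟨j, hrI i hj, rfl⟩)
      exact (Submodule.smul_mem_iff _ h1).mp h2
    have hall : ∀ z : K ⊗[R] A, π z ∈
        Submodule.span K ((fun i => π ((1 : K) ⊗ₜ[R] b i)) '' I) := by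
      intro z
      have hz : z ∈ (⊤ : Submodule K (K ⊗[R] A)) := trivial
      rw [← Submodule.baseChange_top, ← hb, Submodule.baseChange_span, ← Set.range_comp] at hz
      induction hz using Submodule.span_induction with
      | mem _ h => obtain ⟨i, rfl⟩ := h; exact hbs i
      | zero => simp
      | add _ _ _ _ h h' => rw [map_add]; exact Submodule.add_mem _ h h'
      | smul k _ _ h => rw [map_smul]; exact Submodule.smul_mem _ _ h
    obtain ⟨y, hyI, hy⟩ := (Finsupp.mem_span_image_iff_linearCombination K).mp (hall f)
    refine ⟨y, hyI, (hπ _).mp ?_⟩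
    rw [map_sub, ← hy, sub_eq_zero, Finsupp.linearCombination_apply,
      Finsupp.linearCombination_apply, Finsupp.sum, Finsupp.sum, map_sum]
    simp
  suffices hy0 : y = 0 by simpa [hy0] using hy
  have hev : ∀ l, ∑ j ∈ y.support, y j * χ l (b j) = 0 := by
    intro l
    have h := (hy.map (Algebra.TensorProduct.lift (Algebra.ofId K K) (χ l)
      (fun _ _ => .all _ _))).eq_zero
    rw [map_sub, hf l, zero_sub, neg_eq_zero, Finsupp.linearCombination_apply, Finsupp.sum,
      map_sum] at h
    simpa using h
  by_contra hne
  obtain ⟨i, hi⟩ := Finsupp.support_nonempty_iff.mpr hne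
  let p : Σ J : Finset ℕ, J := ⟨y.support, ⟨i, hi⟩⟩
  obtain ⟨hn, hq⟩ := hdual p hyI
  have hmK : algebraMap R K (m p) ≠ 0 := hC _ (.inr ⟨p, rfl⟩)
  have hsum : ∀ l ∈ T p, ∑ j ∈ y.support, y j * algebraMap R K (n p j l) = 0 := by
    intro l hl
    have hl' : l ∈ ⋃ p, (T p : Set Λ) := Set.mem_iUnion.mpr ⟨p, hl⟩
    rw [← mul_zero (algebraMap R K (m p)), ← hev ⟨l, hl'⟩, Finset.mul_sum]
    refine Finset.sum_congr rfl fun j hj => ?_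
    rw [← hχ ⟨l, hl'⟩ (b j) (m p) (n p j l) (hn j hj l hl)]
    ring
  have : y i * algebraMap R K (m p) ^ 2 = 0 := by
    calc y i * algebraMap R K (m p) ^ 2
        = ∑ j ∈ y.support.attach, y j * algebraMap R K (∑ l ∈ T p, q p l * n p j l) := by
          rw [Finset.sum_eq_single (⟨i, hi⟩ : y.support)]
          · rw [hq]; simp [p]
          · intro j _ hj
            rw [hq]
            simp [p, hj]
          · simp
      _ = ∑ j ∈ y.support, y j * algebraMap R K (∑ l ∈ T p, q p l * n p j l) :=
          Finset.sum_attach y.support fun j => y j * algebraMap R K (∑ l ∈ T p, q p l * n p j l)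
      _ = ∑ l ∈ T p, algebraMap R K (q p l) * ∑ j ∈ y.support, y j * algebraMap R K (n p j l) := by
          simp only [map_sum, map_mul, Finset.mul_sum]
          rw [Finset.sum_comm]
          exact Finset.sum_congr rfl fun _ _ => Finset.sum_congr rfl fun _ _ => by ring
      _ = 0 := Finset.sum_eq_zero fun l hl => by rw [hsum l hl, mul_zero]
  rcases mul_eq_zero.mp this with h | h
  · exact Finsupp.mem_support_iff.mp hi h
  · exact hmK (pow_eq_zero_iff two_ne_zero |>.mp h)

theorem AlgebraicGeometry.exists_lift_localizationAway {X V U : Scheme.{u}} [IsIntegral X]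
    (i : U ⟶ X) [IsOpenImmersion i] (s : U ⟶ V) {W : X.Opens} (hW : IsAffineOpen W) [Nonempty W]
    {V' : V.Opens} (hV' : IsAffineOpen V') (hne : ∃ y, s y ∈ V') :
    ∃ (d : Γ(X, W)) (t : Spec (CommRingCat.of (Localization.Away d)) ⟶ U)
      (σ : Γ(V, V') ⟶ CommRingCat.of (Localization.Away d)), d ≠ 0 ∧ IsOpenImmersion t ∧
      t ≫ i = Spec.map (CommRingCat.ofHom (algebraMap _ _)) ≫ hW.fromSpec ∧
      t ≫ s = Spec.map σ ≫ hV'.fromSpec := by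
  obtain ⟨y, hy⟩ := hne
  obtain ⟨z, hzO, hzW⟩ := nonempty_preirreducible_inter (i ''ᵁ (s ⁻¹ᵁ V')).isOpen W.isOpen
    ⟨i y, y, hy, rfl⟩ (Set.nonempty_coe_sort.mp ‹_›)
  obtain ⟨d, hdle, hd⟩ := hW.exists_basicOpen_le (V := i ''ᵁ (s ⁻¹ᵁ V')) ⟨z, hzO⟩ hzW
  let g := Spec.map (CommRingCat.ofHom (algebraMap Γ(X, W) (Localization.Away d))) ≫ hW.fromSpec
  have hg : ∀ q, g q ∈ i ''ᵁ (s ⁻¹ᵁ V') := by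
    intro q
    refine hdle ?_
    rw [← hW.fromSpec_image_basicOpen]
    refine ⟨_, ?_, rfl⟩
    have := (PrimeSpectrum.localization_away_comap_range (Localization.Away d) d).le ⟨q, rfl⟩
    exact this
  have hgi : Set.range g ⊆ Set.range i := by
    rintro _ ⟨q, rfl⟩
    obtain ⟨u, -, hu⟩ := hg q
    exact ⟨u, hu⟩
  let t := IsOpenImmersion.lift i g hgi
  have ht : t ≫ i = g := IsOpenImmersion.lift_fac _ _ _
  have hts : Set.range (t ≫ s) ⊆ Set.range hV'.fromSpec := by
    rw [hV'.range_fromSpec]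
    rintro _ ⟨q, rfl⟩
    obtain ⟨u, hu, hu'⟩ := hg q
    have : u = t q := i.isOpenEmbedding.injective (hu'.trans (by rw [← Scheme.Hom.comp_apply, ht]))
    subst this
    exact hu
  refine ⟨d, t, Spec.preimage (IsOpenImmersion.lift hV'.fromSpec (t ≫ s) hts), ?_, ?_, ht, ?_⟩
  · rintro rfl
    simp at hd
  · have : IsOpenImmersion (t ≫ i) := ht ▸ inferInstanceAs (IsOpenImmersion (_ ≫ _))
    exact IsOpenImmersion.of_comp t i
  · rw [Spec.map_preimage, IsOpenImmersion.lift_fac]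

/-- Density of the specialized sections in the part of a fiber lying over an affine open. -/
theorem AlgebraicGeometry.exists_countable_section_mem_of_specialization
    {X V : Scheme.{u}} [IsIntegral X] (π : V ⟶ X) [LocallyOfFiniteType π]
    {Λ : Type v} (U : Λ → X.Opens) (s : ∀ l : Λ, (U l : Scheme.{u}) ⟶ V)
    (hsec : ∀ l : Λ, s l ≫ π = (U l).ι) (hdense : Dense (⋃ l : Λ, Set.range (s l)))
    {W : X.Opens} (hW : IsAffineOpen W) [Nonempty W]
    {V' : V.Opens} (hV' : IsAffineOpen V') (e : V' ≤ π ⁻¹ᵁ W) :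
    ∃ C : Set Γ(X, W), C.Countable ∧ 0 ∉ C ∧
      ∀ (K : Type u) [Field K] (φ : Γ(X, W) ⟶ CommRingCat.of K), (∀ c ∈ C, φ.hom c ≠ 0) →
        ∀ (O : (pullback π (Spec.map φ ≫ hW.fromSpec)).Opens), ∀ p ∈ O,
          pullback.fst π (Spec.map φ ≫ hW.fromSpec) p ∈ V' →
          ∃ (l : Λ) (xl : Spec (CommRingCat.of K) ⟶ (U l : Scheme.{u}))
            (w : Spec (CommRingCat.of K) ⟶ pullback π (Spec.map φ ≫ hW.fromSpec)),
            xl ≫ (U l).ι = Spec.map φ ≫ hW.fromSpec ∧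
            w ≫ pullback.fst π _ = xl ≫ s l ∧ w ≫ pullback.snd π _ = 𝟙 _ ∧
            ∃ q, w q ∈ O := by
  let R := Γ(X, W)
  let A := Γ(V, V')
  let L := FractionRing R
  let ρ : R ⟶ A := π.appLE W V' e
  have hρ : Spec.map ρ ≫ hW.fromSpec = hV'.fromSpec ≫ π :=
    IsAffineOpen.SpecMap_appLE_fromSpec π hW hV' e
  let _ : Algebra R A := ρ.hom.toAlgebra
  have : Algebra.FiniteType R A := LocallyOfFiniteType.finiteType_appLE π hW hV' e
  let Λ' := {l : Λ // ∃ y, s l y ∈ V'}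
  choose d t σ hd hopen ht hσ using fun l : Λ' =>
    exists_lift_localizationAway (U l.1).ι (s l.1) hW hV' l.2
  have hσR : ∀ l, ρ ≫ σ l = CommRingCat.ofHom (algebraMap R (Localization.Away (d l))) := by
    intro l
    apply Spec.map_injective
    rw [← cancel_mono hW.fromSpec, Spec.map_comp, Category.assoc, hρ, ← Category.assoc, ← hσ,
      Category.assoc, hsec, ht]
  let σ' : ∀ l, A →ₐ[R] Localization.Away (d l) := fun l =>
    { (σ l).hom with commutes' := fun r => DFunLike.congr_fun (congrArg CommRingCat.Hom.hom (hσR l)) r }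
  have hunit : ∀ l, IsUnit (algebraMap R L (d l)) := fun l =>
    ((map_ne_zero_iff _ (IsFractionRing.injective R L)).mpr (hd l)).isUnit
  let j : ∀ l, Localization.Away (d l) →ₐ[R] L := fun l =>
    IsLocalization.liftAlgHom (M := Submonoid.powers (d l)) (f := Algebra.ofId R L) (by
      rintro ⟨_, n, rfl⟩
      exact (map_pow (algebraMap R L) (d l) n).symm ▸ (hunit l).pow n)
  have hj : ∀ l, Function.Injective (j l) := by
    intro l
    refine (IsLocalization.lift_injective_iff _).mpr fun x y => ?_
    have h1 : Function.Injective (algebraMap R (Localization.Away (d l))) :=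
      IsLocalization.injective _ (powers_le_nonZeroDivisors_of_noZeroDivisors (hd l))
    rw [h1.eq_iff]
    exact (IsFractionRing.injective R L).eq_iff.symm
  obtain ⟨T, C, hT, hC, hC0, H⟩ := exists_countable_isNilpotent_of_specialization.{u}
    (fun l => (j l).comp (σ' l)) (by
      intro a ha
      by_contra hnil
      have hne : ((PrimeSpectrum.basicOpen a : TopologicalSpace.Opens (PrimeSpectrum A)) :
          Set (PrimeSpectrum A)).Nonempty := by
        rw [Set.nonempty_iff_ne_empty, ne_eq, TopologicalSpace.Opens.coe_eq_empty,
          PrimeSpectrum.basicOpen_eq_bot_iff]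
        exact hnil
      obtain ⟨_, ⟨q, hq, rfl⟩, hu⟩ := hdense.inter_open_nonempty
        (hV'.fromSpec ''ᵁ PrimeSpectrum.basicOpen a)
        (hV'.fromSpec ''ᵁ PrimeSpectrum.basicOpen a).isOpen (hne.image _)
      obtain ⟨l, y, hy⟩ := Set.mem_iUnion.mp hu
      have hyV : s l y ∈ V' := by
        rw [hy]
        exact hV'.range_fromSpec.le ⟨q, rfl⟩
      let l' : Λ' := ⟨l, y, hyV⟩
      have hnt : Nontrivial (Localization.Away (d l')) := (j l').toRingHom.domain_nontrivial
      obtain ⟨_, ⟨y₁, hy₁, rfl⟩, ⟨_, ⟨y₂, rfl⟩, hy₂⟩⟩ := nonempty_preirreducible_inter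
        ((U l).ι ''ᵁ (s l ⁻¹ᵁ (hV'.fromSpec ''ᵁ PrimeSpectrum.basicOpen a))).isOpen
        ((U l).ι ''ᵁ (t l').opensRange).isOpen
        ⟨_, y, by rw [SetLike.mem_coe, Scheme.Hom.mem_preimage, hy]; exact ⟨q, hq, rfl⟩, rfl⟩
        ⟨_, _, ⟨(Nonempty.some inferInstance : PrimeSpectrum _), rfl⟩, rfl⟩
      obtain rfl := (U l).ι.isOpenEmbedding.injective hy₂
      obtain ⟨q', hq', hq''⟩ := hy₁
      have h1 : hV'.fromSpec (Spec.map (σ l') y₂) = s l (t l' y₂) := by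
        rw [← Scheme.Hom.comp_apply, ← hσ l']; rfl
      have h2 := hV'.fromSpec.isOpenEmbedding.injective (hq''.trans h1.symm)
      subst h2
      have h3 : σ l' a = 0 := (map_eq_zero_iff _ (hj l')).mp (ha l')
      exact hq' (show (σ l').hom a ∈ y₂.asIdeal from h3 ▸ y₂.asIdeal.zero_mem))
  refine ⟨C ∪ d '' T, hC.union (hT.image d), ?_, ?_⟩
  · rintro (h | ⟨l, -, hl⟩)
    · exact hC0 h
    · exact hd l hl
  intro K _ φ hφ O p hpO hpV
  let _ : Algebra R K := φ.hom.toAlgebra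
  let φ' : ∀ l : T, Localization.Away (d l) →ₐ[R] K := fun l =>
    IsLocalization.liftAlgHom (M := Submonoid.powers (d l)) (f := Algebra.ofId R K) (by
      rintro ⟨_, n, rfl⟩
      have : IsUnit (algebraMap R K (d l)) := (hφ _ (.inr ⟨l, l.2, rfl⟩)).isUnit
      exact (map_pow (algebraMap R K) (d l) n).symm ▸ this.pow n)
  let χ : T → A →ₐ[R] K := fun l => (φ' l).comp (σ' l)
  let B := TensorProduct R K A
  let iA : A ⟶ CommRingCat.of B :=
    CommRingCat.ofHom (Algebra.TensorProduct.includeRight : A →ₐ[R] B).toRingHom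
  let iK : CommRingCat.of K ⟶ CommRingCat.of B :=
    CommRingCat.ofHom (Algebra.TensorProduct.includeLeft : K →ₐ[R] B).toRingHom
  have hcomm : ρ ≫ iA = φ ≫ iK := by
    ext r
    exact ((Algebra.TensorProduct.includeRight : A →ₐ[R] B).commutes r).trans
      ((Algebra.TensorProduct.includeLeft : K →ₐ[R] B).commutes r).symm
  let g : Spec (CommRingCat.of B) ⟶ pullback π (Spec.map φ ≫ hW.fromSpec) :=
    pullback.lift (Spec.map iA ≫ hV'.fromSpec) (Spec.map iK) (by
      rw [Category.assoc, ← hρ, ← Spec.map_comp_assoc, ← Spec.map_comp_assoc, hcomm])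
  have hpg : ∃ z, g z = p := by
    let P := pullback π (Spec.map φ ≫ hW.fromSpec)
    let κ := P.fromSpecResidueField p
    have hκ : Set.range (κ ≫ pullback.fst π _) ⊆ Set.range hV'.fromSpec := by
      rw [hV'.range_fromSpec]
      rintro _ ⟨z, rfl⟩
      have : κ z = p := by
        exact (P.range_fromSpecResidueField p).le ⟨z, rfl⟩
      rw [Scheme.Hom.comp_apply, this]
      exact hpV
    obtain ⟨α, hα⟩ := Spec.map_surjective (IsOpenImmersion.lift hV'.fromSpec _ hκ)
    obtain ⟨β, hβ⟩ := Spec.map_surjective (κ ≫ pullback.snd π _)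
    have hα' : Spec.map α ≫ hV'.fromSpec = κ ≫ pullback.fst π _ := by
      rw [hα, IsOpenImmersion.lift_fac]
    have hαβ : ρ ≫ α = φ ≫ β := by
      apply Spec.map_injective
      rw [← cancel_mono hW.fromSpec, Spec.map_comp, Spec.map_comp, Category.assoc, hρ,
        reassoc_of% hα', pullback.condition, Category.assoc, hβ, Category.assoc]
    let _ : Algebra R (P.residueField p) := (φ ≫ β).hom.toAlgebra
    let αA : A →ₐ[R] P.residueField p :=
      { α.hom with commutes' := fun r => DFunLike.congr_fun (congrArg CommRingCat.Hom.hom hαβ) r }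
    let βK : K →ₐ[R] P.residueField p := { β.hom with commutes' := fun r => rfl }
    let γ : CommRingCat.of B ⟶ P.residueField p :=
      CommRingCat.ofHom (Algebra.TensorProduct.lift βK αA (fun _ _ => .all _ _)).toRingHom
    have hγA : iA ≫ γ = α := by
      ext a
      exact (Algebra.TensorProduct.lift_tmul _ _ (fun _ _ => .all _ _) _ _).trans
        ((congrArg (· * _) (map_one βK)).trans (one_mul _))
    have hγK : iK ≫ γ = β := by
      ext a
      exact (Algebra.TensorProduct.lift_tmul _ _ (fun _ _ => .all _ _) _ _).trans
        ((congrArg (_ * ·) (map_one αA)).trans (mul_one _))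
    have hγg : Spec.map γ ≫ g = κ := by
      apply pullback.hom_ext
      · rw [Category.assoc, pullback.lift_fst, ← Spec.map_comp_assoc, hγA, hα']
      · rw [Category.assoc, pullback.lift_snd, ← Spec.map_comp, hγK, hβ]
    obtain ⟨z, hz⟩ := (P.range_fromSpecResidueField p).ge rfl
    exact ⟨Spec.map γ z, by rw [← Scheme.Hom.comp_apply, hγg, hz]⟩
  obtain ⟨z, rfl⟩ := hpg
  obtain ⟨_, ⟨f, rfl⟩, hzf, hfO⟩ :=
    PrimeSpectrum.isTopologicalBasis_basic_opens.exists_subset_of_mem_open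
      (a := z) (u := (g ⁻¹ᵁ O).carrier) hpO (g ⁻¹ᵁ O).isOpen
  have hf : ¬ IsNilpotent f := fun h => by
    have := (PrimeSpectrum.basicOpen_eq_bot_iff f).mpr h
    exact (this.le hzf : z ∈ (⊥ : TopologicalSpace.Opens (PrimeSpectrum B)))
  have : ¬ ∀ l : T, Algebra.TensorProduct.lift (Algebra.ofId K K) (χ l)
      (fun _ _ => .all _ _) f = 0 := by
    refine fun h => hf (H K (fun c hc => hφ c (.inl hc)) χ ?_ f h)
    intro l a m n hmn
    have : algebraMap R (Localization.Away (d l)) m * σ' l a = algebraMap R _ n := by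
      apply hj l
      simpa using hmn
    simpa [χ] using congrArg (φ' l) this
  push Not at this
  obtain ⟨l, hl⟩ := this
  let ev : CommRingCat.of B ⟶ CommRingCat.of K := CommRingCat.ofHom
    (Algebra.TensorProduct.lift (Algebra.ofId K K) (χ l) (fun _ _ => .all _ _)).toRingHom
  let φl : CommRingCat.of (Localization.Away (d l)) ⟶ CommRingCat.of K :=
    CommRingCat.ofHom (φ' l).toRingHom
  have hevA : iA ≫ ev = σ l ≫ φl := by
    ext a
    exact (Algebra.TensorProduct.lift_tmul _ _ (fun _ _ => .all _ _) _ _).trans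
      ((congrArg (· * _) (map_one (Algebra.ofId K K))).trans (one_mul _))
  have hevK : iK ≫ ev = 𝟙 _ := by
    ext a
    exact (Algebra.TensorProduct.lift_tmul _ _ (fun _ _ => .all _ _) _ _).trans
      ((congrArg (_ * ·) (map_one (χ l))).trans (mul_one _))
  have hφl : CommRingCat.ofHom (algebraMap R (Localization.Away (d l))) ≫ φl = φ := by
    ext r
    exact (φ' l).commutes r
  refine ⟨l, Spec.map φl ≫ t l, Spec.map ev ≫ g, ?_, ?_, ?_, ?_⟩
  · rw [Category.assoc, ht, ← Spec.map_comp_assoc, hφl]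
  · rw [Category.assoc, pullback.lift_fst, ← Spec.map_comp_assoc, hevA, Category.assoc, hσ,
      Spec.map_comp_assoc]
  · rw [Category.assoc, pullback.lift_snd, ← Spec.map_comp, hevK, Spec.map_id]
  · let o : Spec (CommRingCat.of K) := (⊥ : PrimeSpectrum K)
    refine ⟨o, ?_⟩
    rw [Scheme.Hom.comp_apply]
    refine hfO (a := Spec.map ev o) ?_
    change ¬ (ev f ∈ (⊥ : Ideal K))
    exact hl

/-- **A dense set of rational sections specializes to dense fibers (Proposition 2.1).**
Let `k` be a field, `X` an integral scheme of finite type over `k`, `V` a scheme of finite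
type over `k`, and `π : V → X` a `k`-morphism.  Let `(U_λ, s_λ)` be a family (of arbitrary
cardinality) of rational sections of `π`, i.e. each `U_λ ⊆ X` is a dense open subscheme and
`s_λ : U_λ → V` satisfies `π ∘ s_λ = incl`.  Assume that the union of the images `s_λ(U_λ)`
is Zariski dense in `V`.  Then there is a countable collection `(Yᵢ)` of proper closed
subsets of `X` such that: for every field extension `K/k` and every `K`-point
`x : Spec K → X` factoring through every `U_λ` and avoiding every `Yᵢ`, the set of
`K`-points `{s_λ ∘ x}` of the fiber `V_x = V ×_X Spec K` is Zariski dense in `V_x`. -/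
theorem dense_rational_sections_give_dense_fibers
    {k : Type u} [Field k]
    (X : Scheme.{u}) (sX : X ⟶ Spec (CommRingCat.of k))
    [IsIntegral X] [LocallyOfFiniteType sX] [QuasiCompact sX]
    (V : Scheme.{u}) (sV : V ⟶ Spec (CommRingCat.of k))
    [LocallyOfFiniteType sV] [QuasiCompact sV]
    (π : V ⟶ X) (hπ : π ≫ sX = sV)
    {Λ : Type v} (U : Λ → X.Opens) (hUdense : ∀ l, Dense (U l : Set X))
    (s : ∀ l : Λ, ((U l : Scheme.{u})) ⟶ V)
    (hsec : ∀ l : Λ, s l ≫ π = (U l).ι)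
    (hdense : Dense (⋃ l : Λ, Set.range (s l).base)) :
    ∃ Y : ℕ → Set X,
      (∀ i, IsClosed (Y i)) ∧ (∀ i, Y i ≠ Set.univ) ∧
      ∀ (K : Type u) [Field K] [Algebra k K]
        (x : Spec (CommRingCat.of K) ⟶ X),
        x ≫ sX = Spec.map (CommRingCat.ofHom (algebraMap k K)) →
        (∀ l : Λ, ∃ xl : Spec (CommRingCat.of K) ⟶ (U l : Scheme.{u}),
          xl ≫ (U l).ι = x) →
        (∀ i, ∀ p ∈ Set.range x.base, p ∉ Y i) →
        Dense {p : (pullback π x : Scheme.{u}) |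
          ∃ (l : Λ) (xl : Spec (CommRingCat.of K) ⟶ (U l : Scheme.{u})),
            xl ≫ (U l).ι = x ∧
            ∃ w : Spec (CommRingCat.of K) ⟶ pullback π x,
              w ≫ pullback.fst π x = xl ≫ s l ∧
              w ≫ pullback.snd π x = 𝟙 _ ∧ p ∈ Set.range w.base} := by
  have : LocallyOfFiniteType π := by
    have : LocallyOfFiniteType (π ≫ sX) := hπ ▸ inferInstance
    exact locallyOfFiniteType_of_comp π sX
  have : IsLocallyNoetherian V := LocallyOfFiniteType.isLocallyNoetherian sV
  have : CompactSpace V := QuasiCompact.compactSpace_of_compactSpace sV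
  have : IsNoetherian V := {}
  obtain ⟨W, hW, hxW, -⟩ := exists_isAffineOpen_mem_and_subset
    (TopologicalSpace.Opens.mem_top (Nonempty.some inferInstance : X))
  have : Nonempty W := ⟨⟨_, hxW⟩⟩
  have hcov : ∀ v : (π ⁻¹ᵁ W : V.Opens), ∃ V' : V.Opens, IsAffineOpen V' ∧ v.1 ∈ V' ∧
      V' ≤ π ⁻¹ᵁ W := fun v => exists_isAffineOpen_mem_and_subset v.2
  choose V' hV' hv hle using hcov
  obtain ⟨F, hF⟩ := (TopologicalSpace.NoetherianSpace.isCompact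
    ((π ⁻¹ᵁ W : V.Opens) : Set V)).elim_nhds_subcover' (fun v h => V' ⟨v, h⟩)
    (fun v h => (V' ⟨v, h⟩).isOpen.mem_nhds (hv ⟨v, h⟩))
  choose C hC hC0 H using fun v =>
    exists_countable_section_mem_of_specialization π U s hsec hdense hW (hV' v) (hle v)
  obtain ⟨Y, hY⟩ := (((F.countable_toSet.biUnion fun v _ => hC v).image
    fun c => ((X.basicOpen c : Set X))ᶜ).insert ((W : Set X)ᶜ)).exists_eq_range
    (Set.insert_nonempty _ _)
  have hYmem : ∀ i, Y i = (W : Set X)ᶜ ∨ ∃ v, ∃ c ∈ C v, ((X.basicOpen c : Set X))ᶜ = Y i := by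
    intro i
    rcases hY.ge ⟨i, rfl⟩ with h | ⟨c, hc, h⟩
    · exact .inl h
    · obtain ⟨v, -, hcv⟩ := Set.mem_iUnion₂.mp hc
      exact .inr ⟨v, c, hcv, h⟩
  refine ⟨Y, fun i => ?_, fun i => ?_, ?_⟩
  · rcases hYmem i with h | ⟨v, c, -, h⟩
    · exact h ▸ W.isOpen.isClosed_compl
    · exact h ▸ (X.basicOpen c).isOpen.isClosed_compl
  · rcases hYmem i with h | ⟨v, c, hc, h⟩
    · rw [h, Ne, Set.compl_univ_iff]
      exact Set.Nonempty.ne_empty ⟨_, hxW⟩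
    · rw [← h, Ne, Set.compl_univ_iff, TopologicalSpace.Opens.coe_eq_empty,
        basicOpen_eq_bot_iff]
      exact fun h0 => hC0 v (h0 ▸ hc)
  intro K _ _ x _ _ hxY
  have hxW' : Set.range x ⊆ Set.range hW.fromSpec := by
    rw [hW.range_fromSpec]
    intro p hp
    obtain ⟨i, hi⟩ := hY.le (Set.mem_insert _ _)
    by_contra hpW
    exact hxY i p hp (hi ▸ hpW)
  obtain ⟨φ, hφ⟩ := Spec.map_surjective (IsOpenImmersion.lift hW.fromSpec x hxW')
  obtain rfl : Spec.map φ ≫ hW.fromSpec = x := by rw [hφ, IsOpenImmersion.lift_fac]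
  have hφC : ∀ v ∈ F, ∀ c ∈ C v, φ.hom c ≠ 0 := by
    intro v hvF c hc h0
    let o : Spec (CommRingCat.of K) := (⊥ : PrimeSpectrum K)
    obtain ⟨i, hi⟩ := hY.le (Set.mem_insert_of_mem _
      ⟨c, Set.mem_iUnion₂.mpr ⟨v, hvF, hc⟩, rfl⟩)
    refine hxY i _ ⟨o, rfl⟩ (hi ▸ fun hmem => ?_)
    have hmem' : Spec.map φ o ∈ hW.fromSpec ⁻¹ᵁ X.basicOpen c := hmem
    rw [hW.fromSpec_preimage_basicOpen] at hmem'
    exact hmem' (show φ.hom c ∈ (⊥ : Ideal K) from h0)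
  rw [dense_iff_inter_open]
  rintro O hO ⟨p, hp⟩
  have hpW : pullback.fst π (Spec.map φ ≫ hW.fromSpec) p ∈ π ⁻¹ᵁ W := by
    rw [Scheme.Hom.mem_preimage, ← Scheme.Hom.comp_apply, pullback.condition, ← SetLike.mem_coe,
      ← hW.range_fromSpec, ← Category.assoc, Scheme.Hom.comp_apply]
    exact ⟨_, rfl⟩
  obtain ⟨v, hvF, hpv⟩ := Set.mem_iUnion₂.mp (hF hpW)
  obtain ⟨l, xl, w, hxl, hw₁, hw₂, q, hq⟩ := H v K φ (hφC v hvF) ⟨O, hO⟩ p hp hpv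
  exact ⟨w q, hq, l, xl, hxl, w, hw₁, hw₂, q, rfl⟩
end

section
/- Let k ⊆ E ⊆ F ⊆ L be a tower of fields such that L is a finitely generated field extension of k. Suppose that for every field extension K of k and every pair of k-algebra homomorphisms x, x' : L → K, the restrictions of x and x' to E are equal if and only if the restrictions of x and x' to F are equal. Then F is a purely inseparable field extension of E. -/
universe u

open TensorProduct in
/-- If `a ⊗ 1 - 1 ⊗ a` is nilpotent in `L ⊗[E] L`, then `a` is integral over `E`. -/
theorem isIntegral_of_isNilpotent_tmul_sub_tmul {E L : Type*} [Field E] [Field L] [Algebra E L]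
    {a : L} (h : IsNilpotent (a ⊗ₜ[E] (1 : L) - 1 ⊗ₜ[E] a)) : IsIntegral E a := by
  obtain ⟨n, hn⟩ := h
  by_contra hint
  have hnot : a ^ n ∉ Submodule.span E ((fun i : ℕ => a ^ i) '' Set.Iio n) := by
    intro hmem
    have hind : LinearIndependent E (fun i : ℕ => a ^ i) := by
      have := (transcendental_iff_injective (R := E) (x := a)).1
        (fun halg => hint halg.isIntegral)
      have hb := (Polynomial.basisMonomials E).linearIndependent.map'
        (Polynomial.aeval a).toLinearMap (LinearMap.ker_eq_bot.2 this)
      have hpow : (Polynomial.aeval a).toLinearMap ∘ Polynomial.basisMonomials E =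
          fun i : ℕ => a ^ i := by
        ext i
        simp
      rwa [hpow] at hb
    exact (hind.notMem_span_image (s := Set.Iio n) (x := n) (by simp)) hmem
  obtain ⟨φ, hφ, hker⟩ := Submodule.exists_le_ker_of_notMem hnot
  have hlt : ∀ i < n, φ (a ^ i) = 0 := fun i hi =>
    hker (Submodule.subset_span ⟨i, hi, rfl⟩)
  have key := congrArg (TensorProduct.lid E L ∘ LinearMap.rTensor L φ) hn
  rw [sub_eq_add_neg, add_pow] at key
  simp only [Function.comp_apply, map_sum, map_zero] at key
  rw [Finset.sum_range_succ, Finset.sum_eq_zero] at key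
  · simp [Algebra.TensorProduct.tmul_pow, Algebra.TensorProduct.one_def] at key
    exact hφ key
  · intro i hi
    have hi' := hlt i (Finset.mem_range.1 hi)
    have : (a ⊗ₜ[E] (1 : L)) ^ i * (-(1 ⊗ₜ[E] a)) ^ (n - i) * (n.choose i : L ⊗[E] L)
        = (a ^ i) ⊗ₜ[E] ((-a) ^ (n - i) * (n.choose i : L)) := by
      rw [← TensorProduct.tmul_neg, ← map_natCast (Algebra.TensorProduct.includeRight : L →ₐ[E] _)]
      simp only [Algebra.TensorProduct.includeRight_apply, Algebra.TensorProduct.tmul_pow,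
        Algebra.TensorProduct.tmul_mul_tmul, one_pow, one_mul, mul_one]
    rw [this]
    simp [hi']

open TensorProduct in
/-- Descent for a field extension: `a ⊗ 1 = 1 ⊗ a` in `L ⊗[E] L` only if `a` lies in `E`. -/
theorem mem_range_algebraMap_of_tmul_one_eq_one_tmul {E L : Type*} [Field E] [Field L]
    [Algebra E L] {a : L} (h : a ⊗ₜ[E] (1 : L) = 1 ⊗ₜ[E] a) : a ∈ (algebraMap E L).range := by
  by_contra ha
  have hnot : a ∉ Submodule.span E {(1 : L)} := by
    intro hmem
    obtain ⟨c, hc⟩ := Submodule.mem_span_singleton.1 hmem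
    exact ha ⟨c, by rw [← hc, Algebra.smul_def, mul_one]⟩
  obtain ⟨φ, hφ, hker⟩ := Submodule.exists_le_ker_of_notMem hnot
  have h1 : φ 1 = 0 := hker (Submodule.mem_span_singleton_self 1)
  have key := congrArg (TensorProduct.lid E L ∘ LinearMap.rTensor L φ) h
  simp [h1] at key
  exact hφ key

open TensorProduct in
/-- If `a ⊗ 1 - 1 ⊗ a` is nilpotent in `L ⊗[E] L` and `a` is separable over `E`, then `a` lies
in `E`. -/
theorem mem_range_algebraMap_of_isNilpotent_tmul_sub_tmul {E L : Type*} [Field E] [Field L]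
    [Algebra E L] {a : L} (h : IsNilpotent (a ⊗ₜ[E] (1 : L) - 1 ⊗ₜ[E] a))
    (hsep : IsSeparable E a) : a ∈ (algebraMap E L).range := by
  apply mem_range_algebraMap_of_tmul_one_eq_one_tmul
  have hl : Polynomial.aeval (a ⊗ₜ[E] (1 : L)) (minpoly E a) = 0 := by
    have := Polynomial.aeval_algHom_apply
      (Algebra.TensorProduct.includeLeft : L →ₐ[E] L ⊗[E] L) a (minpoly E a)
    simpa using this
  have hr : Polynomial.aeval ((1 : L) ⊗ₜ[E] a) (minpoly E a) = 0 := by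
    have := Polynomial.aeval_algHom_apply
      (Algebra.TensorProduct.includeRight : L →ₐ[E] L ⊗[E] L) a (minpoly E a)
    simpa using this
  have hu : IsUnit (Polynomial.aeval (a ⊗ₜ[E] (1 : L)) (minpoly E a).derivative) := by
    have := Polynomial.aeval_algHom_apply
      (Algebra.TensorProduct.includeLeft : L →ₐ[E] L ⊗[E] L) a (minpoly E a).derivative
    rw [Algebra.TensorProduct.includeLeft_apply] at this
    rw [this]
    exact (IsUnit.mk0 _ (hsep.aeval_derivative_ne_zero (minpoly.aeval E a))).map _
  refine (Polynomial.existsUnique_nilpotent_sub_and_aeval_eq_zero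
    (by rw [hl]; exact IsNilpotent.zero) hu).unique ⟨?_, hl⟩ ⟨h, hr⟩
  simp

open TensorProduct in
/-- If any two `k`-embeddings of `L` into a field that agree on `E` also agree at `a`, then
`a ⊗ 1 - 1 ⊗ a` is nilpotent in `L ⊗[E] L`. -/
theorem isNilpotent_tmul_sub_tmul_of_algHom_eq {k L : Type u} [Field k] [Field L] [Algebra k L]
    {E : IntermediateField k L} {a : L}
    (h : ∀ (K : Type u) [Field K] [Algebra k K] (x x' : L →ₐ[k] K),
      (∀ e : L, e ∈ E → x e = x' e) → x a = x' a) :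
    IsNilpotent (a ⊗ₜ[E] (1 : L) - 1 ⊗ₜ[E] a) := by
  rw [← mem_nilradical, nilradical_eq_sInf, Ideal.mem_sInf]
  intro P hP
  have : P.IsPrime := hP
  let π : L ⊗[E] L →ₐ[k] P.ResidueField := IsScalarTower.toAlgHom k _ _
  have hπ := h P.ResidueField (π.comp Algebra.TensorProduct.includeLeft)
    (π.comp ((Algebra.TensorProduct.includeRight : L →ₐ[E] L ⊗[E] L).restrictScalars k)) ?_
  · rw [← Ideal.algebraMap_residueField_eq_zero, map_sub, sub_eq_zero]
    exact hπ
  · intro e he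
    have : e ⊗ₜ[E] (1 : L) = 1 ⊗ₜ[E] e := by
      simpa [Algebra.smul_def] using
        TensorProduct.smul_tmul (R := E) (⟨e, he⟩ : E) (1 : L) (1 : L)
    exact congrArg π this

/-- **Function-field form of Rosenlicht's separation lemma (Lemma 5.1).**
Let `k ⊆ E ⊆ F ⊆ L` be a tower of fields such that `L` is a finitely generated field
extension of `k`.  Suppose that for every field extension `K` of `k` and every pair of
`k`-algebra homomorphisms `x, x' : L → K`, the restrictions of `x` and `x'` to `E` are equal
if and only if the restrictions of `x` and `x'` to `F` are equal.  Then `F` is a purely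
inseparable field extension of `E`. -/
theorem purelyInseparable_of_separating_same_points
    {k L : Type u} [Field k] [Field L] [Algebra k L]
    (hfg : (⊤ : IntermediateField k L).FG)
    {E F : IntermediateField k L} (hEF : E ≤ F)
    (hsep : ∀ (K : Type u) [Field K] [Algebra k K] (x x' : L →ₐ[k] K),
      ((∀ a : L, a ∈ E → x a = x' a) ↔ (∀ a : L, a ∈ F → x a = x' a))) :
    IsPurelyInseparable E (IntermediateField.extendScalars hEF) := by
  refine isPurelyInseparable_iff.2 fun x => ?_
  have hx := isNilpotent_tmul_sub_tmul_of_algHom_eq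
    fun K _ _ f g hE => (hsep K f g).1 hE x x.2
  refine ⟨(isIntegral_algHom_iff (IntermediateField.extendScalars hEF).val
    Subtype.val_injective).1 (isIntegral_of_isNilpotent_tmul_sub_tmul hx), fun hs => ?_⟩
  obtain ⟨c, hc⟩ := mem_range_algebraMap_of_isNilpotent_tmul_sub_tmul hx
    (IsSeparable.map (IntermediateField.extendScalars hEF).val Subtype.val_injective hs)
  exact ⟨c, Subtype.ext hc⟩
end

section
/- Let k be an uncountable algebraically closed field, X an integral scheme of finite type over k admitting a locally closed immersion into some projective space ℙⁿ_k, and G a nonempty set of dominant k-morphisms X → X closed under composition. Suppose the invariant function field is trivial: every element f of the function field k(X) satisfying g*(f) = f for all g ∈ G lies in the image of the structure map k → k(X). Then there exists a closed point x of X (equivalently, a k-point, since k is algebraically closed) whose orbit {g(x) : g ∈ G} is Zariski dense in X. -/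
universe u

open AlgebraicGeometry CategoryTheory CategoryTheory.Limits MvPolynomial

attribute [local instance] MvPolynomial.gradedAlgebra

noncomputable section

/-- The map `k → k(X)` on function fields induced by the structure morphism
`sX : X ⟶ Spec k`. -/
def structMapToFunctionField {k : Type u} [Field k] (X : Scheme.{u}) [IsIntegral X]
    (sX : X ⟶ Spec (CommRingCat.of k)) : CommRingCat.of k ⟶ X.functionField :=
  (Scheme.ΓSpecIso (CommRingCat.of k)).inv ≫ sX.app ⊤ ≫
    X.presheaf.germ (sX ⁻¹ᵁ ⊤) (genericPoint X) (by simp)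

/-- Auxiliary version of `exists_det_ne_zero` for families indexed by `Fin n`. -/
theorem exists_det_ne_zero_fin {k K : Type*} [Field k] [Field K] [Algebra k K]
    (M : Set (K →+* K)) (hne : M.Nonempty) (hcomp : ∀ σ ∈ M, ∀ τ ∈ M, σ.comp τ ∈ M)
    (hfix : ∀ c : K, (∀ σ ∈ M, σ c = c) → c ∈ Set.range (algebraMap k K)) (n : ℕ) (v : Fin n → K)
    (hv : LinearIndependent k v) :
    ∃ σ : Fin n → K →+* K, (∀ i, σ i ∈ M) ∧ (Matrix.of fun i j ↦ σ i (v j)).det ≠ 0 := by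
  induction n with
  | zero => exact ⟨fun i ↦ i.elim0, fun i ↦ i.elim0, by simp⟩
  | succ n ih =>
    obtain ⟨σ, hσ, hdet⟩ := ih (fun i ↦ v i.castSucc) (hv.comp _ (Fin.castSucc_injective n))
    set A : Matrix (Fin n) (Fin n) K := Matrix.of fun i j ↦ σ i (v j.castSucc) with hA
    by_contra! hcon
    let c : Fin n → K := A⁻¹.mulVec fun i ↦ σ i (v (Fin.last n))
    have hAu : IsUnit A.det := isUnit_iff_ne_zero.mpr hdet
    have hτ : ∀ τ ∈ M, τ (v (Fin.last n)) = ∑ j, τ (v j.castSucc) * c j := by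
      intro τ hτ
      have h0 := hcon (Fin.snoc σ τ) (fun i ↦ by
        refine Fin.lastCases ?_ (fun i ↦ ?_) i <;> simp [hτ, hσ])
      let B : Matrix (Fin n) Unit K := Matrix.of fun i _ ↦ σ i (v (Fin.last n))
      let C : Matrix Unit (Fin n) K := Matrix.of fun _ j ↦ τ (v j.castSucc)
      let D : Matrix Unit Unit K := Matrix.of fun _ _ ↦ τ (v (Fin.last n))
      let e : Fin n ⊕ Unit ≃ Fin (n + 1) :=
        (Equiv.sumCongr (Equiv.refl _) (Equiv.ofUnique Unit (Fin 1))).trans finSumFinEquiv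
      have hinl : ∀ i, e (Sum.inl i) = i.castSucc := fun i ↦ rfl
      have hinr : ∀ i, e (Sum.inr i) = Fin.last n := fun i ↦ rfl
      rw [← Matrix.det_submatrix_equiv_self e] at h0
      have hblock : (Matrix.of fun i j ↦ (Fin.snoc σ τ : Fin (n + 1) → K →+* K) i (v j)).submatrix
          e e = Matrix.fromBlocks A B C D := by
        ext (i | i) (j | j) <;> simp [hinl, hinr, A, B, C, D]
      have := Matrix.invertibleOfIsUnitDet A hAu
      rw [hblock, Matrix.det_fromBlocks₁₁, mul_eq_zero, or_iff_right hdet] at h0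
      simp only [Matrix.det_unique, Matrix.sub_apply, sub_eq_zero, Matrix.mul_assoc] at h0
      rw [Matrix.invOf_eq_nonsing_inv] at h0
      exact h0
    have hc : ∀ j, ∀ h ∈ M, h (c j) = c j := by
      intro j h hh
      have hker : (h.mapMatrix A).mulVec (fun j ↦ h (c j) - c j) = 0 := by
        ext i
        have h1 := hτ _ (hcomp h hh _ (hσ i))
        have h2 := congrArg h (hτ _ (hσ i))
        simp only [map_sum, map_mul] at h2
        simp only [RingHom.comp_apply] at h1
        rw [h1, eq_comm, ← sub_eq_zero, ← Finset.sum_sub_distrib] at h2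
        simpa [Matrix.mulVec, dotProduct, mul_sub, A] using h2
      have hu : (h.mapMatrix A).det ≠ 0 := by
        rw [← RingHom.map_det]
        exact (map_ne_zero h).mpr hdet
      exact sub_eq_zero.mp (congrFun (Matrix.eq_zero_of_mulVec_eq_zero hu hker) j)
    choose a ha using fun j ↦ hfix (c j) (hc j)
    obtain ⟨τ, hτM⟩ := hne
    have hlin : v (Fin.last n) = ∑ j, a j • v j.castSucc := by
      apply τ.injective
      rw [hτ τ hτM, map_sum]
      refine Finset.sum_congr rfl fun j _ ↦ ?_
      rw [Algebra.smul_def, map_mul, ha, hc j τ hτM, mul_comm]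
    have := Fintype.linearIndependent_iff.mp hv (Fin.snoc a (-1))
      (by simp [Fin.sum_univ_castSucc, hlin]) (Fin.last n)
    simp at this

/-- Elements of a field `K` that are linearly independent over the subfield `k` fixed by a
semigroup `M` of endomorphisms have a nonvanishing determinant of conjugates by `M`. -/
theorem exists_det_ne_zero {k K ι : Type*} [Field k] [Field K] [Algebra k K] [Fintype ι]
    [DecidableEq ι]
    (M : Set (K →+* K)) (hne : M.Nonempty) (hcomp : ∀ σ ∈ M, ∀ τ ∈ M, σ.comp τ ∈ M)
    (hfix : ∀ c : K, (∀ σ ∈ M, σ c = c) → c ∈ Set.range (algebraMap k K)) (v : ι → K)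
    (hv : LinearIndependent k v) :
    ∃ σ : ι → K →+* K, (∀ i, σ i ∈ M) ∧ (Matrix.of fun i j ↦ σ i (v j)).det ≠ 0 := by
  let e := Fintype.equivFin ι
  obtain ⟨σ, hσ, hdet⟩ := exists_det_ne_zero_fin M hne hcomp hfix _ (v ∘ e.symm)
    (hv.comp _ e.symm.injective)
  refine ⟨σ ∘ e, fun i ↦ hσ _, ?_⟩
  rw [← Matrix.det_submatrix_equiv_self e] at hdet
  convert hdet using 2
  ext i j
  simp

open Cardinal in
theorem isAlgebraic_of_rank_le_aleph0 {k L : Type*} [Field k] [Uncountable k] [Field L]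
    [Algebra k L] (h : Module.rank k L ≤ ℵ₀) : Algebra.IsAlgebraic k L := by
  refine ⟨fun x ↦ ?_⟩
  by_contra hx
  have := (Transcendental.linearIndependent_sub_inv hx).cardinal_lift_le_rank
  have h2 : lift #k ≤ ℵ₀ := this.trans (by simpa using h)
  exact (Cardinal.aleph0_lt_mk (α := k)).not_ge (by simpa using h2)

open Cardinal in
/-- In a domain of countable dimension over an uncountable field, countably many nonzero elements
all avoid some maximal ideal. -/
theorem exists_isMaximal_forall_notMem {k A κ : Type*} [Field k] [Uncountable k] [CommRing A]
    [IsDomain A] [Algebra k A] (hA : Module.rank k A ≤ ℵ₀) [Countable κ] (f : κ → A)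
    (hf : ∀ i, f i ≠ 0) : ∃ m : Ideal A, m.IsMaximal ∧ ∀ i, f i ∉ m := by
  let S : Submonoid A := MonoidHom.mrange (FreeMonoid.lift f)
  have hfS : ∀ i, f i ∈ S := fun i ↦ ⟨FreeMonoid.of i, by simp⟩
  have hScard : Countable S := by
    have : Countable (FreeMonoid κ) := inferInstanceAs (Countable (List κ))
    exact (Set.countable_range (FreeMonoid.lift f)).to_subtype
  have hS : S ≤ nonZeroDivisors A := by
    change MonoidHom.mrange _ ≤ _
    rw [FreeMonoid.mrange_lift, Submonoid.closure_le]
    rintro _ ⟨i, rfl⟩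
    exact mem_nonZeroDivisors_of_ne_zero (hf i)
  let B := Localization S
  have : IsDomain B := IsLocalization.isDomain_localization hS
  obtain ⟨M, hM⟩ := Ideal.exists_maximal B
  let : Field (B ⧸ M) := Ideal.Quotient.field M
  let b := Module.Free.chooseBasis k A
  have : Countable (Module.Free.ChooseBasisIndex k A) := by
    rw [← Cardinal.mk_le_aleph0_iff, ← Module.Free.rank_eq_card_chooseBasisIndex]
    exact hA
  let w : Module.Free.ChooseBasisIndex k A × S → B := fun p ↦ IsLocalization.mk' B (b p.1) p.2
  have hspan : Submodule.span k (Set.range w) = ⊤ := by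
    refine eq_top_iff.mpr fun x _ ↦ ?_
    obtain ⟨a, s, rfl⟩ := IsLocalization.exists_mk'_eq S x
    let T : A →ₗ[k] B :=
      LinearMap.mulRight k (IsLocalization.mk' B 1 s) ∘ₗ (Algebra.linearMap A B).restrictScalars k
    have hT : ∀ a, T a = IsLocalization.mk' B a s := fun a ↦
      (IsLocalization.mk'_eq_mul_mk'_one (S := B) a s).symm
    have hle : ⊤ ≤ (Submodule.span k (Set.range w)).comap T := by
      rw [← b.span_eq, Submodule.span_le]
      rintro _ ⟨i, rfl⟩
      exact Submodule.subset_span ⟨(i, s), (hT _).symm⟩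
    exact hT a ▸ hle (Submodule.mem_top (x := a))
  have hB : Module.rank k B ≤ ℵ₀ := by
    rw [← rank_top, ← hspan]
    exact (rank_span_le _).trans (Set.countable_range w).le_aleph0
  have hL : Module.rank k (B ⧸ M) ≤ ℵ₀ := by
    have := rank_range_le (Ideal.Quotient.mkₐ k M).toLinearMap
    rw [LinearMap.range_eq_top.mpr Ideal.Quotient.mk_surjective, rank_top] at this
    exact this.trans hB
  have := isAlgebraic_of_rank_le_aleph0 hL
  let φ : A →ₐ[k] B ⧸ M := (Ideal.Quotient.mkₐ k M).comp (IsScalarTower.toAlgHom k A B)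
  refine ⟨RingHom.ker φ, ?_, fun i hi ↦ ?_⟩
  · have hint : φ.toRingHom.IsIntegral := by
      refine RingHom.IsIntegral.tower_top (algebraMap k A) _ ?_
      rw [AlgHom.toRingHom_eq_coe, AlgHom.comp_algebraMap]
      exact fun x ↦ Algebra.IsIntegral.isIntegral x
    have hbot : (⊥ : Ideal (B ⧸ M)).IsMaximal := Ideal.bot_isMaximal
    exact Ideal.isMaximal_comap_of_isIntegral_of_isMaximal' φ.toRingHom hint ⊥
  · have hu : IsUnit (φ (f i)) :=
      (IsLocalization.map_units B (⟨f i, hfS i⟩ : S)).map (Ideal.Quotient.mk M)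
    exact hu.ne_zero hi

open Cardinal in
theorem Algebra.FiniteType.rank_le_aleph0 (k A : Type u) [Field k] [CommRing A] [Algebra k A]
    [Algebra.FiniteType k A] : Module.rank k A ≤ ℵ₀ := by
  obtain ⟨n, f, hf⟩ := Algebra.FiniteType.iff_quotient_mvPolynomial''.mp ‹Algebra.FiniteType k A›
  have h := rank_range_le f.toLinearMap
  rw [LinearMap.range_eq_top.mpr hf, rank_top] at h
  refine h.trans ?_
  rw [MvPolynomial.rank_eq_lift, Cardinal.lift_le_aleph0]
  exact Cardinal.mk_le_aleph0

/-- The map `k → Γ(X, U)` induced by the structure morphism `sX : X ⟶ Spec k`. -/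
def scalarSection {k : Type u} [Field k] {X : Scheme.{u}} (sX : X ⟶ Spec (CommRingCat.of k))
    (U : X.Opens) : k →+* Γ(X, U) :=
  ((Scheme.ΓSpecIso (CommRingCat.of k)).inv ≫ sX.appLE ⊤ U le_top).hom

theorem scalarSection_finiteType {k : Type u} [Field k] {X : Scheme.{u}}
    (sX : X ⟶ Spec (CommRingCat.of k)) [LocallyOfFiniteType sX] {U : X.Opens}
    (hU : IsAffineOpen U) : (scalarSection sX U).FiniteType :=
  (sX.finiteType_appLE (isAffineOpen_top _) hU le_top).comp
    (RingHom.FiniteType.of_surjective _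
      (Scheme.ΓSpecIso (CommRingCat.of k)).symm.commRingCatIsoToRingEquiv.surjective)

theorem appLE_scalarSection {k : Type u} [Field k] {X : Scheme.{u}}
    (sX : X ⟶ Spec (CommRingCat.of k)) (g : X ⟶ X) (hg : g ≫ sX = sX) (U W : X.Opens)
    (h : W ≤ g ⁻¹ᵁ U) (c : k) :
    g.appLE U W h (scalarSection sX U c) = scalarSection sX W c := by
  have := Scheme.Hom.appLE_comp_appLE g sX ⊤ U W le_top h
  simp only [scalarSection, CommRingCat.hom_comp, RingHom.comp_apply]
  rw [← CommRingCat.comp_apply, this]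
  simp only [hg]

/-- Over an uncountable field, countably many nonempty opens of an integral scheme locally of
finite type have a common closed point. -/
theorem exists_isClosed_singleton_forall_mem {k : Type u} [Field k] [Uncountable k]
    {X : Scheme.{u}} (sX : X ⟶ Spec (CommRingCat.of k)) [IsIntegral X] [LocallyOfFiniteType sX]
    {κ : Type*} [Countable κ] (V : κ → X.Opens) (hV : ∀ i, genericPoint X ∈ V i) :
    ∃ x : X, IsClosed ({x} : Set X) ∧ ∀ i, x ∈ V i := by
  obtain ⟨_, ⟨U, hU, rfl⟩, hηU, -⟩ :=
    X.isBasis_affineOpens.exists_subset_of_mem_open (Set.mem_univ (genericPoint X)) isOpen_univ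
  change IsAffineOpen U at hU
  have : Nonempty U := ⟨⟨_, hηU⟩⟩
  choose f hfV hηf using fun i ↦ hU.exists_basicOpen_le ⟨genericPoint X, hV i⟩ hηU
  have hf : ∀ i, f i ≠ 0 := by
    intro i h0
    have := hηf i
    simp [h0] at this
  let : Algebra k Γ(X, U) := (scalarSection sX U).toAlgebra
  have : Algebra.FiniteType k Γ(X, U) := scalarSection_finiteType sX hU
  obtain ⟨m, hm, hfm⟩ := exists_isMaximal_forall_notMem
    (Algebra.FiniteType.rank_le_aleph0 k Γ(X, U)) f hf
  let y : Spec Γ(X, U) := ⟨m, hm.isPrime⟩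
  have hy : IsClosed ({y} : Set (Spec Γ(X, U))) :=
    (PrimeSpectrum.isClosed_singleton_iff_isMaximal _).mpr hm
  have : JacobsonSpace X := LocallyOfFiniteType.jacobsonSpace sX
  refine ⟨hU.fromSpec y, ?_, fun i ↦ hfV i ?_⟩
  · apply isClosed_singleton_of_isLocallyClosed_singleton
    rw [← Set.image_singleton]
    exact hy.isLocallyClosed.image hU.fromSpec.isOpenEmbedding.isInducing
      hU.fromSpec.isOpenEmbedding.isOpen_range.isLocallyClosed
  · change y ∈ hU.fromSpec ⁻¹ᵁ X.basicOpen (f i)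
    rw [hU.fromSpec_preimage_basicOpen]
    exact hfm i

section

variable {X : Scheme.{u}}

/-- The pullback `g^*` on the function field of a morphism `g` fixing the generic point. -/
def genericStalkMap [IsIntegral X] (g : X ⟶ X) (hg : g (genericPoint X) = genericPoint X) :
    X.functionField →+* X.functionField :=
  (eqToHom (show X.presheaf.stalk (genericPoint X) =
    X.presheaf.stalk (g.base (genericPoint X)) by rw [hg]) ≫ g.stalkMap (genericPoint X)).hom

theorem germ_eqToHom (U : X.Opens) {x y : X} (h : x = y) (hx : x ∈ U) (s : Γ(X, U)) :
    eqToHom (show X.presheaf.stalk x = X.presheaf.stalk y by rw [h])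
      (X.presheaf.germ U x hx s) = X.presheaf.germ U y (h ▸ hx) s := by
  subst h
  simp

theorem genericStalkMap_germ [IsIntegral X] (g : X ⟶ X)
    (hg : g (genericPoint X) = genericPoint X) (U : X.Opens) (hU : genericPoint X ∈ U)
    (s : Γ(X, U)) :
    genericStalkMap g hg (X.presheaf.germ U _ hU s) =
      X.presheaf.germ (g ⁻¹ᵁ U) (genericPoint X) (show g _ ∈ U from hg.symm ▸ hU) (g.app U s) := by
  have := germ_eqToHom U hg.symm hU s
  simp only [genericStalkMap, CommRingCat.hom_comp, RingHom.comp_apply]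
  refine (congrArg (g.stalkMap (genericPoint X)) this).trans ?_
  exact Scheme.Hom.germ_stalkMap_apply g U (genericPoint X) (hg.symm ▸ hU) s

theorem genericStalkMap_comp [IsIntegral X] (g g' : X ⟶ X)
    (hg : g (genericPoint X) = genericPoint X) (hg' : g' (genericPoint X) = genericPoint X)
    (h : (g ≫ g') (genericPoint X) = genericPoint X) :
    genericStalkMap (g ≫ g') h = (genericStalkMap g hg).comp (genericStalkMap g' hg') := by
  ext f
  obtain ⟨U, hU, s, rfl⟩ := X.presheaf.exists_germ_eq f
  refine (genericStalkMap_germ _ h U hU s).trans (Eq.symm ?_)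
  refine (congrArg (genericStalkMap g hg) (genericStalkMap_germ g' hg' U hU s)).trans ?_
  refine (genericStalkMap_germ g hg (g' ⁻¹ᵁ U) _ _).trans ?_
  simp
  rfl

theorem map_genericPoint_of_isDominant [IsIntegral X] (g : X ⟶ X) [IsDominant g] :
    g (genericPoint X) = genericPoint X := by
  have h := (genericPoint_spec X).image g.continuous
  rw [Set.image_univ, g.denseRange.closure_range] at h
  exact h.eq (genericPoint_spec X)

theorem germ_scalarSection {k : Type u} [Field k] [IsIntegral X]
    (sX : X ⟶ Spec (CommRingCat.of k)) (U : X.Opens) (hU : genericPoint X ∈ U) (c : k) :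
    X.presheaf.germ U _ hU (scalarSection sX U c) = structMapToFunctionField X sX c := by
  simp only [scalarSection, structMapToFunctionField, Scheme.Hom.appLE, CommRingCat.hom_comp,
    RingHom.comp_apply]
  exact X.presheaf.germ_res_apply _ _ _ _

theorem genericPoint_mem_preimage [IsIntegral X] (g : X ⟶ X) [IsDominant g] (U : X.Opens)
    (hU : genericPoint X ∈ U) : genericPoint X ∈ g ⁻¹ᵁ U := by
  change g _ ∈ U
  rwa [map_genericPoint_of_isDominant g]

/-- For `x` in a suitable nonempty open, a `k`-linear combination of the independent sections `v`
vanishing along the `G`-orbit of `x` is trivial. -/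
theorem exists_opens_forall_eq_zero {k : Type u} [Field k] [IsIntegral X]
    (sX : X ⟶ Spec (CommRingCat.of k)) (G : Set (X ⟶ X)) (hGne : G.Nonempty)
    (hGover : ∀ g ∈ G, g ≫ sX = sX) (hGdom : ∀ g ∈ G, IsDominant g)
    (hGcomp : ∀ g ∈ G, ∀ g' ∈ G, g ≫ g' ∈ G)
    (htrivial : ∀ f : X.functionField,
      (∀ g ∈ G, ∀ hg : g (genericPoint X) = genericPoint X, genericStalkMap g hg f = f) →
      f ∈ Set.range (structMapToFunctionField X sX))
    (U : X.Opens) (hU : genericPoint X ∈ U) {ι : Type*} [Fintype ι] (v : ι → Γ(X, U))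
    (hv : ∀ c : ι → k, ∑ j, scalarSection sX U (c j) * v j = 0 → c = 0) :
    ∃ V : X.Opens, genericPoint X ∈ V ∧ ∀ x ∈ V, ∀ c : ι → k,
      (∀ g ∈ G, g x ∉ X.basicOpen (∑ j, scalarSection sX U (c j) * v j)) → c = 0 := by
  classical
  have : Nonempty U := ⟨⟨_, hU⟩⟩
  let : Algebra k X.functionField := (structMapToFunctionField X sX).hom.toAlgebra
  let M : Set (X.functionField →+* X.functionField) :=
    {σ | ∃ g ∈ G, ∃ hg : g (genericPoint X) = genericPoint X, σ = genericStalkMap g hg}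
  obtain ⟨σ, hσ, hdet⟩ := exists_det_ne_zero (k := k) M
    (by
      obtain ⟨g, hg⟩ := hGne
      have := hGdom g hg
      exact ⟨_, g, hg, map_genericPoint_of_isDominant g, rfl⟩)
    (by
      rintro _ ⟨g, hg, hgη, rfl⟩ _ ⟨g', hg', hgη', rfl⟩
      have hη : (g ≫ g') (genericPoint X) = genericPoint X := by simp [hgη, hgη']
      exact ⟨g ≫ g', hGcomp g hg g' hg', hη, (genericStalkMap_comp g g' hgη hgη' hη).symm⟩)
    (fun c hc ↦ htrivial c fun g hg hgη ↦ hc _ ⟨g, hg, hgη, rfl⟩)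
    (fun j ↦ X.presheaf.germ U _ hU (v j))
    (by
      rw [Fintype.linearIndependent_iff]
      intro c hc
      refine congrFun (hv c (germ_injective_of_isIntegral X _ hU ?_))
      rw [map_zero, map_sum, ← hc]
      refine Finset.sum_congr rfl fun j _ ↦ ?_
      rw [map_mul, germ_scalarSection, Algebra.smul_def]
      rfl)
  choose g hgG hgη hσg using hσ
  let W : X.Opens := Finset.univ.inf fun i ↦ g i ⁻¹ᵁ U
  have hW : ∀ i, W ≤ g i ⁻¹ᵁ U := fun i ↦ Finset.inf_le (Finset.mem_univ i)
  have hηW : genericPoint X ∈ W := by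
    rw [← SetLike.mem_coe, TopologicalSpace.Opens.coe_finset_inf]
    simp only [Finset.inf_set_eq_iInter, Set.mem_iInter]
    intro i _
    have := hGdom _ (hgG i)
    exact genericPoint_mem_preimage (g i) U hU
  let m : Matrix ι ι Γ(X, W) := Matrix.of fun i j ↦ (g i).appLE U W (hW i) (v j)
  have hm : (X.presheaf.germ W _ hηW).hom m.det =
      (Matrix.of fun i j ↦ σ i (X.presheaf.germ U _ hU (v j))).det := by
    rw [RingHom.map_det]
    congr 1
    ext i j
    simp only [RingHom.mapMatrix_apply, Matrix.map_apply, Matrix.of_apply, m, hσg]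
    rw [genericStalkMap_germ _ _ _ hU]
    simp only [Scheme.Hom.appLE, CommRingCat.hom_comp, RingHom.comp_apply]
    exact X.presheaf.germ_res_apply _ _ _ _
  refine ⟨X.basicOpen m.det, ?_, fun x hx c hc ↦ ?_⟩
  · rw [X.mem_basicOpen _ _ hηW]
    exact isUnit_iff_ne_zero.mpr (hm ▸ hdet)
  have hxW : x ∈ W := X.basicOpen_le _ hx
  let e : Γ(X, W) →+* X.residueField x := (X.evaluation W x hxW).hom
  have hem : (e.mapMatrix m).det ≠ 0 := by
    rw [← RingHom.map_det]
    exact (X.evaluation_ne_zero_iff_mem_basicOpen x hxW _).mpr hx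
  have hzero : (e.mapMatrix m).mulVec (fun j ↦ e (scalarSection sX W (c j))) = 0 := by
    ext i
    have h0 : e ((g i).appLE U W (hW i) (∑ j, scalarSection sX U (c j) * v j)) = 0 := by
      refine (X.evaluation_eq_zero_iff_notMem_basicOpen x hxW _).mpr fun h ↦ hc _ (hgG i) ?_
      rw [Scheme.basicOpen_appLE] at h
      exact h.2
    rw [map_sum, map_sum] at h0
    simp only [map_mul, appLE_scalarSection sX _ (hGover _ (hgG i))] at h0
    rw [Pi.zero_apply, ← h0]
    exact Finset.sum_congr rfl fun j _ ↦ mul_comm _ _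
  ext j
  have := congrFun (Matrix.eq_zero_of_mulVec_eq_zero hem hzero) j
  exact (map_eq_zero (e.comp (scalarSection sX W))).mp this

end

theorem exists_isClosed_dense_orbit
    {k : Type u} [Field k] [Uncountable k]
    (X : Scheme.{u}) (sX : X ⟶ Spec (CommRingCat.of k))
    [IsIntegral X] [LocallyOfFiniteType sX]
    (G : Set (X ⟶ X)) (hGne : G.Nonempty)
    (hGover : ∀ g ∈ G, g ≫ sX = sX)
    (hGdom : ∀ g ∈ G, IsDominant g)
    (hGcomp : ∀ g ∈ G, ∀ g' ∈ G, g ≫ g' ∈ G)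
    (htrivial : ∀ f : X.functionField,
      (∀ g ∈ G, ∀ hg : g (genericPoint X) = genericPoint X, genericStalkMap g hg f = f) →
      f ∈ Set.range (structMapToFunctionField X sX)) :
    ∃ x : X, IsClosed ({x} : Set X) ∧ Dense {p : X | ∃ g ∈ G, p = g.base x} := by
  obtain ⟨_, ⟨U, hU, rfl⟩, hηU, -⟩ :=
    X.isBasis_affineOpens.exists_subset_of_mem_open (Set.mem_univ (genericPoint X)) isOpen_univ
  change IsAffineOpen U at hU
  let : Algebra k Γ(X, U) := (scalarSection sX U).toAlgebra
  have : Algebra.FiniteType k Γ(X, U) := scalarSection_finiteType sX hU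
  let b := Module.Free.chooseBasis k Γ(X, U)
  have : Countable (Module.Free.ChooseBasisIndex k Γ(X, U)) := by
    rw [← Cardinal.mk_le_aleph0_iff, ← Module.Free.rank_eq_card_chooseBasisIndex]
    exact Algebra.FiniteType.rank_le_aleph0 k Γ(X, U)
  choose V hηV hV using fun t : Finset (Module.Free.ChooseBasisIndex k Γ(X, U)) ↦
    exists_opens_forall_eq_zero sX G hGne hGover hGdom hGcomp htrivial U hηU
      (fun j : t ↦ b j) (fun c hc ↦ funext (Fintype.linearIndependent_iff.mp
        (b.linearIndependent.comp _ Subtype.val_injective) c hc))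
  obtain ⟨x, hx, hxV⟩ := exists_isClosed_singleton_forall_mem sX V hηV
  refine ⟨x, hx, dense_iff_inter_open.mpr fun O hO hOne ↦ ?_⟩
  have hηO : genericPoint X ∈ (⟨O, hO⟩ : X.Opens) :=
    ((genericPoint_spec X).mem_open_set_iff hO).mpr (by simpa using hOne)
  obtain ⟨f, hfO, hηf⟩ := hU.exists_basicOpen_le ⟨genericPoint X, hηO⟩ hηU
  by_contra hcon
  have hf : ∑ j : (b.repr f).support, scalarSection sX U (b.repr f j) * b j = f := by
    rw [Finset.sum_coe_sort (b.repr f).support fun j ↦ scalarSection sX U (b.repr f j) * b j]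
    exact b.linearCombination_repr f
  have hc := hV (b.repr f).support x (hxV _) (fun j ↦ b.repr f j) fun g hg hgx ↦
    hcon ⟨g x, hfO (hf ▸ hgx), g, hg, rfl⟩
  have : f = 0 := by
    rw [← hf]
    exact Finset.sum_eq_zero fun j _ ↦ by rw [show b.repr f j = 0 from congrFun hc j]; simp
  simp [this] at hηf

/-- **The Medvedev–Scanlon conjecture over uncountable fields (Corollary 6.1).**
Let `k` be an uncountable algebraically closed field, `X` an irreducible quasi-projective
variety over `k`, and `G` a nonempty semigroup of dominant `k`-morphisms `X → X`.  If the
only rational functions on `X` fixed by every `g ∈ G` (via the pullback `g^*` on the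
function field, i.e. the stalk map of `g` at the generic point) are the constants — the
image of the structure map `k → k(X)` — then some closed point (equivalently, `k`-point)
of `X` has a Zariski dense `G`-orbit. -/
theorem medvedev_scanlon_uncountable
    {k : Type u} [Field k] [IsAlgClosed k] [Uncountable k]
    (X : Scheme.{u}) (sX : X ⟶ Spec (CommRingCat.of k))
    [IsIntegral X] [LocallyOfFiniteType sX] [QuasiCompact sX]
    (hqp : IsQuasiProjectiveOver X sX)
    (G : Set (X ⟶ X)) (hGne : G.Nonempty)
    (hGover : ∀ g ∈ G, g ≫ sX = sX)
    (hGdom : ∀ g ∈ G, IsDominant g)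
    (hGcomp : ∀ g ∈ G, ∀ g' ∈ G, g ≫ g' ∈ G)
    (htrivial : ∀ f : X.functionField,
      (∀ g ∈ G, ∀ hg : g.base (genericPoint X) = genericPoint X,
        g.stalkMap (genericPoint X)
          ((eqToHom (show X.presheaf.stalk (genericPoint X) =
              X.presheaf.stalk (g.base (genericPoint X)) by rw [hg])) f) = f) →
      f ∈ Set.range (structMapToFunctionField X sX)) :
    ∃ x : X, IsClosed ({x} : Set X) ∧ Dense {p : X | ∃ g ∈ G, p = g.base x} := by
  exact exists_isClosed_dense_orbit X sX G hGne hGover hGdom hGcomp fun f hf ↦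
    htrivial f fun g hg hgη ↦ hf g hg hgη

end
end

section
/- Let k be a field, K a finitely generated field extension of k, and G a set of k-algebra homomorphisms K → K that is closed under composition. Then there exists a countable subset H ⊆ G, also closed under composition, such that the fixed fields coincide: {a ∈ K : h(a) = a for all h ∈ H} = {a ∈ K : g(a) = a for all g ∈ G}. -/
universe u

/-- In an Artinian module, the intersection of a family of submodules is already the intersection
of a finite subfamily. -/
theorem IsArtinian.exists_finite_biInf_eq {R M ι : Type*} [Ring R] [AddCommGroup M] [Module R M]
    [IsArtinian R M] (p : ι → Submodule R M) (S : Set ι) :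
    ∃ T ⊆ S, T.Finite ∧ ⨅ i ∈ T, p i = ⨅ i ∈ S, p i := by
  obtain ⟨N, ⟨T, ⟨hTS, hT⟩, rfl⟩, hmin⟩ := exists_minimal_of_wellFoundedLT
    (· ∈ (fun T : Set ι => ⨅ i ∈ T, p i) '' {T | T ⊆ S ∧ T.Finite})
    ⟨_, ∅, ⟨Set.empty_subset S, Set.finite_empty⟩, rfl⟩
  refine ⟨T, hTS, hT, le_antisymm (le_iInf₂ fun i hi => ?_) (biInf_mono hTS)⟩
  have hle := hmin ⟨insert i T, ⟨Set.insert_subset hi hTS, hT.insert i⟩, rfl⟩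
    (biInf_mono (Set.subset_insert i T))
  exact hle.trans (biInf_le p (Set.mem_insert i T))

/-- In a module exhausted by countably many Artinian submodules, the common kernel of a family of
linear maps is already the common kernel of a countable subfamily. -/
theorem LinearMap.exists_countable_forall_apply_eq_zero {R M N ι : Type*} [Ring R]
    [AddCommGroup M] [Module R M] [AddCommGroup N] [Module R N] (V : ℕ → Submodule R M)
    [∀ n, IsArtinian R (V n)] (hV : ∀ x, ∃ n, x ∈ V n) (f : ι → M →ₗ[R] N) (S : Set ι) :
    ∃ T ⊆ S, T.Countable ∧ ∀ x, (∀ i ∈ T, f i x = 0) → ∀ i ∈ S, f i x = 0 := by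
  choose T hTS hT hTeq using fun n =>
    IsArtinian.exists_finite_biInf_eq (fun i => LinearMap.ker ((f i).domRestrict (V n))) S
  refine ⟨⋃ n, T n, Set.iUnion_subset hTS, Set.countable_iUnion fun n => (hT n).countable,
    fun x hx i hi => ?_⟩
  obtain ⟨n, hn⟩ := hV x
  have hmem : (⟨x, hn⟩ : V n) ∈ ⨅ i ∈ T n, LinearMap.ker ((f i).domRestrict (V n)) := by
    simp only [Submodule.mem_iInf, LinearMap.mem_ker, LinearMap.domRestrict_apply]
    exact fun j hj => hx j (Set.mem_iUnion_of_mem n hj)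
  rw [hTeq n] at hmem
  simp only [Submodule.mem_iInf, LinearMap.mem_ker, LinearMap.domRestrict_apply] at hmem
  exact hmem i hi

theorem Submonoid.countable_closure {M : Type*} [Monoid M] {s : Set M} (hs : s.Countable) :
    (Submonoid.closure s : Set M).Countable := by
  have := hs.to_subtype
  refine (Set.countable_range fun l : List s => (l.map Subtype.val).prod).mono fun x hx => ?_
  obtain ⟨l, hl, rfl⟩ := Submonoid.exists_list_of_mem_closure hx
  lift l to List s using hl
  exact ⟨l, rfl⟩

/-- Whether endomorphisms of a finitely generated field extension fix a given element is detected
by the vanishing of a polynomial at the generators and their images. -/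
theorem exists_mvPolynomial_aeval_eq_zero_iff_apply_eq {k K : Type*} [Field k] [Field K]
    [Algebra k K] {s : Set K} {a : K} (ha : a ∈ IntermediateField.adjoin k s) :
    ∃ P : MvPolynomial (s ⊕ s) k, ∀ g : K →ₐ[k] K,
      MvPolynomial.aeval (Sum.elim Subtype.val (g ∘ Subtype.val)) P = 0 ↔ g a = a := by
  obtain ⟨p, q, rfl⟩ := (IntermediateField.mem_adjoin_iff k a).1 ha
  refine ⟨.rename .inl q * .rename .inr p - .rename .inl p * .rename .inr q, fun g => ?_⟩
  have hg (r : MvPolynomial s k) : MvPolynomial.aeval (g ∘ Subtype.val) r =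
      g (MvPolynomial.aeval Subtype.val r) := (MvPolynomial.comp_aeval_apply _ g r).symm
  simp only [map_sub, map_mul, MvPolynomial.aeval_rename, Sum.elim_comp_inl, Sum.elim_comp_inr,
    hg, map_div₀]
  by_cases hq : MvPolynomial.aeval (Subtype.val : s → K) q = 0
  · simp [hq]
  · rw [div_eq_div_iff ((map_ne_zero g).2 hq) hq, sub_eq_zero, mul_comm]

/-- **Countable subsemigroup with the same fixed field (Corollary 6.2(a), field-theoretic form).**
Let `k` be a field, `K` a finitely generated field extension of `k`, and `G` a set of
`k`-algebra homomorphisms `K → K` that is closed under composition.  Then there exists a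
countable subset `H ⊆ G`, also closed under composition, such that the fixed fields coincide:
`{a ∈ K : h(a) = a for all h ∈ H} = {a ∈ K : g(a) = a for all g ∈ G}`. -/
theorem exists_countable_subsemigroup_with_same_fixed_field
    {k K : Type u} [Field k] [Field K] [Algebra k K]
    (hfg : (⊤ : IntermediateField k K).FG)
    (G : Set (K →ₐ[k] K))
    (hGcomp : ∀ g ∈ G, ∀ g' ∈ G, g.comp g' ∈ G) :
    ∃ H ⊆ G, H.Countable ∧ (∀ h ∈ H, ∀ h' ∈ H, h.comp h' ∈ H) ∧
      {a : K | ∀ h ∈ H, h a = a} = {a : K | ∀ g ∈ G, g a = a} := by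
  obtain ⟨s, hs⟩ := hfg
  obtain ⟨T, hTG, hT, hker⟩ := LinearMap.exists_countable_forall_apply_eq_zero
    (MvPolynomial.restrictTotalDegree ((s : Set K) ⊕ (s : Set K)) k)
    (fun P => ⟨P.totalDegree, (MvPolynomial.mem_restrictTotalDegree _ _ P).2 le_rfl⟩)
    (fun g : K →ₐ[k] K =>
      (MvPolynomial.aeval (Sum.elim Subtype.val (g ∘ Subtype.val))).toLinearMap) G
  refine ⟨Submonoid.closure T ∩ G, Set.inter_subset_right,
    (Submonoid.countable_closure hT).mono Set.inter_subset_left,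
    fun h hh h' hh' => ⟨mul_mem hh.1 hh'.1, hGcomp h hh.2 h' hh'.2⟩,
    Set.Subset.antisymm (fun a ha => ?_) fun a ha h hh => ha h hh.2⟩
  obtain ⟨P, hP⟩ := exists_mvPolynomial_aeval_eq_zero_iff_apply_eq
    (hs ▸ IntermediateField.mem_top : a ∈ IntermediateField.adjoin k (s : Set K))
  exact fun g hg => (hP g).1 <| hker P
    (fun h hh => (hP h).2 (ha h ⟨Submonoid.subset_closure hh, hTG hh⟩)) g hg
end
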